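/- Let Γ be a countable group, let Λ ◁ Γ be a normal subgroup, and let (P,τ) be a tracial von Neumann algebra on which Γ acts by trace-preserving automorphisms such that (P⋊Λ)' ∩ (P⋊Γ) = ℂ1. Then for any intermediate von Neumann subalgebra P⋊Λ ⊆ N ⊆ P⋊Γ there exists an intermediate subgroup Λ ≤ K ≤ Γ such that N = P⋊K. -/

import Mathlib

/-!
Common framework: we model tracial von Neumann algebras concretely, as von Neumann
algebras `M ⊆ B(H)` (Mathlib's `VonNeumannAlgebra H`, i.e. star-subalgebras equal to
their double commutant) equipped with a faithful tracial state, and we model the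
crossed product `A ⋊ Γ` of a trace-preserving action axiomatically: `M` contains a
copy of `A` and a group `(u γ)` of unitaries normalizing `A`, such that the canonical
trace-preserving conditional expectation `E_A` kills `u γ` for `γ ≠ 1`, and such that
an element of `M` all of whose Fourier coefficients `E_A (x (u γ)*)` vanish is `0`.
Probability-measure-preserving actions `Γ ↷ (X, μ)` are modelled via the associated
trace-preserving action on the abelian von Neumann algebra `A = L^∞(X)`.
-/

noncomputable section

open scoped Classical

namespace CD

/-- A group has infinite conjugacy classes (icc) if every nontrivial conjugacy
class is infinite. -/
def IsICC (Γ : Type) [Group Γ] : Prop :=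
  ∀ γ : Γ, γ ≠ 1 → {g : Γ | ∃ h : Γ, g = h * γ * h⁻¹}.Infinite

/-- A faithful tracial state on (the elements of) a set `M ⊆ B(H)` (in applications,
a von Neumann algebra), given as a globally defined linear functional whose
axioms are imposed on `M`. -/
structure TraceOn (H : Type) [NormedAddCommGroup H] [InnerProductSpace ℂ H] [CompleteSpace H]
    (M : Set (H →L[ℂ] H)) : Type where
  τ : (H →L[ℂ] H) →ₗ[ℂ] ℂ
  unital : τ 1 = 1
  tracial : ∀ x ∈ M, ∀ y ∈ M, τ (x * y) = τ (y * x)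
  star_eq : ∀ x ∈ M, τ (star x) = starRingEnd ℂ (τ x)
  nonneg : ∀ x ∈ M, 0 ≤ (τ (star x * x)).re ∧ (τ (star x * x)).im = 0
  faithful : ∀ x ∈ M, τ (star x * x) = 0 → x = 0

variable {H : Type} [NormedAddCommGroup H] [InnerProductSpace ℂ H] [CompleteSpace H]

/-- The 2-norm `‖x‖₂ = τ(x* x)^{1/2}` associated with a trace. -/
def TraceOn.norm2 {M : Set (H →L[ℂ] H)} (tr : TraceOn H M) (x : H →L[ℂ] H) : ℝ :=
  Real.sqrt (tr.τ (star x * x)).re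

/-- The (unique) trace-preserving conditional expectation from `M` onto a
von Neumann subalgebra `N ⊆ M`. -/
structure CondExpOn (H : Type) [NormedAddCommGroup H] [InnerProductSpace ℂ H] [CompleteSpace H]
    (M N : Set (H →L[ℂ] H)) (tr : TraceOn H M) : Type where
  E : (H →L[ℂ] H) →ₗ[ℂ] (H →L[ℂ] H)
  mem : ∀ x ∈ M, E x ∈ N
  fix : ∀ x ∈ N, E x = x
  bimod : ∀ a ∈ N, ∀ b ∈ N, ∀ x ∈ M, E (a * x * b) = a * E x * b
  star_map : ∀ x ∈ M, E (star x) = star (E x)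
  trace_eq : ∀ x ∈ M, tr.τ (E x) = tr.τ x
  contractive : ∀ x ∈ M, tr.norm2 (E x) ≤ tr.norm2 x

/-- The double commutant of a subset of `B(H)`: the von Neumann algebra
generated by `S` (for `S` a star-closed unital set). -/
def vnGen (S : Set (H →L[ℂ] H)) : Set (H →L[ℂ] H) :=
  Set.centralizer (Set.centralizer S)

/-- Model of the crossed product von Neumann algebra `M = A ⋊ Γ` of a
trace-preserving action `Γ ↷ (A, τ)`: `M` is generated by a copy of `A`
and canonical unitaries `(u γ)` implementing the action, with its canonical
conditional expectation `E_A` onto `A` (characterising the Fourier coefficients),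
together with the group von Neumann algebra `L(Γ) = {u γ : γ}'' ⊆ M` and the
conditional expectation onto it. -/
structure CrossedProduct (Γ : Type) [Group Γ]
    (H : Type) [NormedAddCommGroup H] [InnerProductSpace ℂ H] [CompleteSpace H] : Type where
  M : VonNeumannAlgebra H
  A : VonNeumannAlgebra H
  A_sub : (A : Set (H →L[ℂ] H)) ⊆ (M : Set (H →L[ℂ] H))
  tr : TraceOn H (M : Set (H →L[ℂ] H))
  u : Γ → (H →L[ℂ] H)
  u_mem : ∀ γ, u γ ∈ M
  u_one : u 1 = 1
  u_mul : ∀ γ δ, u γ * u δ = u (γ * δ)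
  u_star : ∀ γ, star (u γ) = u γ⁻¹
  conj_mem : ∀ (γ : Γ), ∀ a ∈ A, u γ * a * star (u γ) ∈ A
  EA : CondExpOn H (M : Set (H →L[ℂ] H)) (A : Set (H →L[ℂ] H)) tr
  EA_u : ∀ γ : Γ, γ ≠ 1 → EA.E (u γ) = 0
  fourier_sep : ∀ x ∈ M, (∀ γ : Γ, EA.E (x * star (u γ)) = 0) → x = 0
  Lg : VonNeumannAlgebra H
  Lg_eq : (Lg : Set (H →L[ℂ] H)) = vnGen (Set.range u)
  Lg_sub : (Lg : Set (H →L[ℂ] H)) ⊆ (M : Set (H →L[ℂ] H))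
  EL : CondExpOn H (M : Set (H →L[ℂ] H)) (Lg : Set (H →L[ℂ] H)) tr

variable {Γ : Type} [Group Γ]

/-- The action `σ_γ = Ad(u γ)` of `Γ` on `B(H)`, restricting to the given
action on `A`. -/
def CrossedProduct.σ (X : CrossedProduct Γ H) (γ : Γ) (x : H →L[ℂ] H) : H →L[ℂ] H :=
  X.u γ * x * star (X.u γ)

/-- The action is properly outer over the center of `P`; for abelian `P` this is
the usual freeness of the action. -/
def ProperlyOuterOn (X : CrossedProduct Γ H) (P : Set (H →L[ℂ] H)) : Prop :=
  ∀ γ : Γ, γ ≠ 1 → ∀ a ∈ P, (∀ b ∈ P, X.σ γ b * a = a * b) → a = 0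

/-- Freeness of the action `Γ ↷ A`. -/
def IsFree (X : CrossedProduct Γ H) : Prop := ProperlyOuterOn X (X.A : Set (H →L[ℂ] H))

/-- Ergodicity of the action `Γ ↷ A`: the fixed points are the scalars. -/
def IsErgodic (X : CrossedProduct Γ H) : Prop :=
  ∀ a ∈ X.A, (∀ γ : Γ, X.σ γ a = a) → ∃ c : ℂ, a = c • (1 : H →L[ℂ] H)

def IsAbelianSet (S : Set (H →L[ℂ] H)) : Prop := ∀ x ∈ S, ∀ y ∈ S, x * y = y * x

/-- `Q` is a `Γ`-invariant subset (in applications, subalgebra). -/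
def InvariantUnder (X : CrossedProduct Γ H) (Q : Set (H →L[ℂ] H)) : Prop :=
  ∀ (γ : Γ), ∀ q ∈ Q, X.σ γ q ∈ Q

/-- The intermediate crossed product `Q ⋊ Γ ⊆ A ⋊ Γ` of a (`Γ`-invariant)
subalgebra `Q ⊆ A`: those elements all of whose Fourier coefficients lie in `Q`. -/
def midCP (X : CrossedProduct Γ H) (Q : Set (H →L[ℂ] H)) : Set (H →L[ℂ] H) :=
  {x | x ∈ X.M ∧ ∀ γ : Γ, X.EA.E (x * star (X.u γ)) ∈ Q}

/-- The intermediate crossed product `A ⋊ K ⊆ A ⋊ Γ` of a subgroup `K ≤ Γ`: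
those elements whose Fourier coefficients are supported on `K`. -/
def subgpCP (X : CrossedProduct Γ H) (K : Subgroup Γ) : Set (H →L[ℂ] H) :=
  {x | x ∈ X.M ∧ ∀ γ : Γ, γ ∉ K → X.EA.E (x * star (X.u γ)) = 0}

/-- The quasinormalizer `QN_M(P)` of `P` inside `M`. -/
def QNset (M P : Set (H →L[ℂ] H)) : Set (H →L[ℂ] H) :=
  {x | x ∈ M ∧ ∃ (n : ℕ) (y : Fin n → (H →L[ℂ] H)), (∀ i, y i ∈ M) ∧
    (∀ p ∈ P, ∃ q : Fin n → (H →L[ℂ] H), (∀ i, q i ∈ P) ∧ p * x = ∑ i, y i * q i) ∧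
    (∀ p ∈ P, ∃ q : Fin n → (H →L[ℂ] H), (∀ i, q i ∈ P) ∧ x * p = ∑ i, q i * y i)}

def IsUnitaryIn (S : Set (H →L[ℂ] H)) (x : H →L[ℂ] H) : Prop :=
  x ∈ S ∧ star x * x = 1 ∧ x * star x = 1

def IsProjIn (S : Set (H →L[ℂ] H)) (p : H →L[ℂ] H) : Prop :=
  p ∈ S ∧ star p = p ∧ p * p = p

/-- The relative commutant `N' ∩ S`. -/
def commutantIn (N S : Set (H →L[ℂ] H)) : Set (H →L[ℂ] H) :=
  {x | x ∈ S ∧ ∀ y ∈ N, x * y = y * x}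

/-- Conjugation `w ( · ) w*` applied to a set. -/
def conjSet (w : H →L[ℂ] H) (S : Set (H →L[ℂ] H)) : Set (H →L[ℂ] H) :=
  (fun y => w * y * star w) '' S

/-- The scalars `ℂ 1 ⊆ B(H)`. -/
def scalars (H : Type) [NormedAddCommGroup H] [InnerProductSpace ℂ H] [CompleteSpace H] :
    Set (H →L[ℂ] H) :=
  Set.range (fun c : ℂ => c • (1 : H →L[ℂ] H))

/-- The extension `P₀ ⊆ P` of `Γ`-algebras is compact: there is a family `F ⊆ P`
with dense `‖·‖₂`-span in `P` such that the `Γ`-orbit of each `f ∈ F` can be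
uniformly approximated by finitely many "`P₀`-finite rank modules". -/
def IsCompactExt (X : CrossedProduct Γ H) (P₀ P : Set (H →L[ℂ] H)) : Prop :=
  ∃ F : Set (H →L[ℂ] H), F ⊆ P ∧
    (∀ p ∈ P, ∀ ε : ℝ, 0 < ε → ∃ (n : ℕ) (c : Fin n → ℂ) (f : Fin n → (H →L[ℂ] H)),
      (∀ i, f i ∈ F) ∧ X.tr.norm2 (p - ∑ i, c i • f i) ≤ ε) ∧
    (∀ f ∈ F, ∀ ε : ℝ, 0 < ε → ∃ (n : ℕ) (ξ : Fin n → (H →L[ℂ] H)) (C : ℝ),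
      (∀ i, ξ i ∈ P) ∧
      ∀ γ : Γ, ∃ κ : Fin n → (H →L[ℂ] H), (∀ i, κ i ∈ P₀) ∧ (∀ i, ‖κ i‖ ≤ C) ∧
        X.tr.norm2 (X.σ γ f - ∑ i, κ i * ξ i) ≤ ε)

/-- The action `Γ ↷ A` is compact: the extension over the scalars is compact. -/
def IsCompactAction (X : CrossedProduct Γ H) : Prop :=
  IsCompactExt X (scalars H) (X.A : Set (H →L[ℂ] H))

/-- The `Γ`-invariant subalgebra `B ⊆ A` gives a mixing extension: for
`t, z ∈ A ⊖ B` one has `‖E_B(t σ_γ(z))‖₂ → 0` as `γ → ∞`. -/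
def IsMixingExt (X : CrossedProduct Γ H) (B : Set (H →L[ℂ] H))
    (EB : CondExpOn H (X.M : Set (H →L[ℂ] H)) B X.tr) : Prop :=
  ∀ t ∈ X.A, ∀ z ∈ X.A, EB.E t = 0 → EB.E z = 0 →
    Filter.Tendsto (fun γ : Γ => X.tr.norm2 (EB.E (t * X.σ γ z))) Filter.cofinite (nhds 0)

/-- A `*`-isomorphism from (the von Neumann algebra with underlying set) `M ⊆ B(H₁)`
onto `N ⊆ B(H₂)`, given as a globally defined map with all axioms imposed on `M`. -/
structure StarIsoOn {H₁ : Type} [NormedAddCommGroup H₁] [InnerProductSpace ℂ H₁]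
    [CompleteSpace H₁] {H₂ : Type} [NormedAddCommGroup H₂] [InnerProductSpace ℂ H₂]
    [CompleteSpace H₂] (M : Set (H₁ →L[ℂ] H₁)) (N : Set (H₂ →L[ℂ] H₂)) : Type where
  Θ : (H₁ →L[ℂ] H₁) → (H₂ →L[ℂ] H₂)
  mem : ∀ x ∈ M, Θ x ∈ N
  map_one : Θ 1 = 1
  map_add : ∀ x ∈ M, ∀ y ∈ M, Θ (x + y) = Θ x + Θ y
  map_smul : ∀ (c : ℂ), ∀ x ∈ M, Θ (c • x) = c • Θ x
  map_mul : ∀ x ∈ M, ∀ y ∈ M, Θ (x * y) = Θ x * Θ y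
  map_star : ∀ x ∈ M, Θ (star x) = star (Θ x)
  inj : ∀ x ∈ M, ∀ y ∈ M, Θ x = Θ y → x = y
  surj : ∀ y ∈ N, ∃ x ∈ M, Θ x = y

/-- `r` is the (Pimsner–Popa/Jones) index of the inclusion `N ⊆ M`, witnessed by a
finite Pimsner–Popa basis `m₁, …, m_k` with `E_N (m_i m_j*) = δ_{ij} p_i`,
`x = ∑ᵢ E_N(x mᵢ*) mᵢ` for `x ∈ M`, and `r = ∑ᵢ τ(pᵢ)`. -/
def HasPPIndex {Mamb : Set (H →L[ℂ] H)} (tr : TraceOn H Mamb)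
    (M N : Set (H →L[ℂ] H)) (r : ℝ) : Prop :=
  ∃ E : (H →L[ℂ] H) →ₗ[ℂ] (H →L[ℂ] H),
    (∀ x ∈ M, E x ∈ N) ∧ (∀ x ∈ N, E x = x) ∧
    (∀ a ∈ N, ∀ b ∈ N, ∀ x ∈ M, E (a * x * b) = a * E x * b) ∧
    (∀ x ∈ M, tr.τ (E x) = tr.τ x) ∧
    ∃ (k : ℕ) (m p : Fin k → (H →L[ℂ] H)),
      (∀ i, m i ∈ M) ∧ (∀ i, p i ∈ N ∧ star (p i) = p i ∧ p i * p i = p i) ∧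
      (∀ i j, E (m i * star (m j)) = if i = j then p i else 0) ∧
      (∀ x ∈ M, x = ∑ i, E (x * star (m i)) * m i) ∧
      r = (∑ i, tr.τ (p i)).re

/-- The inclusion `N ⊆ M` has finite (Pimsner–Popa/Jones) index. -/
def FiniteIndexIn {Mamb : Set (H →L[ℂ] H)} (tr : TraceOn H Mamb)
    (M N : Set (H →L[ℂ] H)) : Prop :=
  ∃ r : ℝ, HasPPIndex tr M N r

/-- `S` (a von Neumann algebra) is a factor: trivial center. -/
def IsFactorSet (S : Set (H →L[ℂ] H)) : Prop :=
  ∀ x ∈ S, (∀ y ∈ S, x * y = y * x) → ∃ c : ℂ, x = c • (1 : H →L[ℂ] H)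

/-- `S` is a II₁ factor (with respect to the trace `tr`): a factor whose
projections realize every trace value in `[0,1]`. -/
def IsII1On {Mamb : Set (H →L[ℂ] H)} (tr : TraceOn H Mamb) (S : Set (H →L[ℂ] H)) : Prop :=
  IsFactorSet S ∧ ∀ r : ℝ, 0 ≤ r → r ≤ 1 →
    ∃ p ∈ S, star p = p ∧ p * p = p ∧ tr.τ p = (r : ℂ)

def IsFinDimSet (S : Set (H →L[ℂ] H)) : Prop :=
  ∃ (n : ℕ) (v : Fin n → (H →L[ℂ] H)), (∀ i, v i ∈ S) ∧
    ∀ x ∈ S, ∃ c : Fin n → ℂ, x = ∑ i, c i • v i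

def IsStarSubalgSet (S : Set (H →L[ℂ] H)) : Prop :=
  (1 : H →L[ℂ] H) ∈ S ∧ (∀ x ∈ S, ∀ y ∈ S, x + y ∈ S) ∧ (∀ x ∈ S, ∀ y ∈ S, x * y ∈ S) ∧
    (∀ (c : ℂ), ∀ x ∈ S, c • x ∈ S) ∧ (∀ x ∈ S, star x ∈ S)

/-- `S` is approximately finite dimensional (with respect to `‖·‖₂`); by Connes'
theorem this is equivalent to amenability for (separable, tracial) von Neumann
algebras. -/
def IsAFD {Mamb : Set (H →L[ℂ] H)} (tr : TraceOn H Mamb) (S : Set (H →L[ℂ] H)) : Prop :=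
  ∃ Q : ℕ → Set (H →L[ℂ] H), (∀ n, Q n ⊆ S) ∧ (∀ n, Q n ⊆ Q (n + 1)) ∧
    (∀ n, IsFinDimSet (Q n)) ∧ (∀ n, IsStarSubalgSet (Q n)) ∧
    ∀ x ∈ S, ∀ ε : ℝ, 0 < ε → ∃ n, ∃ y ∈ Q n, tr.norm2 (x - y) ≤ ε

/-- `S` is diffuse: it has no minimal projections. -/
def IsDiffuseSet (S : Set (H →L[ℂ] H)) : Prop :=
  ∀ p, IsProjIn S p → p ≠ 0 →
    ∃ q, IsProjIn S q ∧ q ≠ 0 ∧ q ≠ p ∧ q * p = q ∧ p * q = q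

/-- The (trace-preserving) action of `Γ` on the subalgebra `Q` is transitive:
`Q` is spanned by finitely many orthogonal minimal projections summing to `1`
which are permuted transitively by `Γ`. -/
def IsTransitiveOn (X : CrossedProduct Γ H) (Q : Set (H →L[ℂ] H)) : Prop :=
  ∃ (n : ℕ) (e : Fin n → (H →L[ℂ] H)),
    (∀ i, e i ∈ Q ∧ star (e i) = e i ∧ e i * e i = e i) ∧
    (∀ i j, i ≠ j → e i * e j = 0) ∧ (∑ i, e i = 1) ∧
    (∀ q ∈ Q, ∃ c : Fin n → ℂ, q = ∑ i, c i • e i) ∧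
    (∀ i j, ∃ γ : Γ, X.σ γ (e i) = e j)

/-- An abelian von Neumann algebra `S` is completely atomic: every nonzero
projection dominates a minimal projection. -/
def IsCompletelyAtomic (S : Set (H →L[ℂ] H)) : Prop :=
  ∀ p, IsProjIn S p → p ≠ 0 →
    ∃ q, IsProjIn S q ∧ q ≠ 0 ∧ q * p = q ∧
      ∀ r, IsProjIn S r → r * q = r → r = 0 ∨ r = q

end CD

section
open scoped Classical ComplexOrder
set_option linter.unusedSectionVars false
namespace CD
open Filter Topology ContinuousLinearMap
variable {H : Type} [NormedAddCommGroup H] [InnerProductSpace ℂ H] [CompleteSpace H]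

/-- weak operator convergence along a filter -/
def WLim {ι : Type*} (l : Filter ι) (z : ι → (H →L[ℂ] H)) (w : H →L[ℂ] H) : Prop :=
  ∀ g h : H, Tendsto (fun i => inner ℂ g (z i h)) l (𝓝 (inner ℂ g (w h)))

theorem exists_wlim {ι : Type*} (U : Ultrafilter ι) (z : ι → (H →L[ℂ] H)) (C : ℝ)
    (hC : ∀ i, ‖z i‖ ≤ C) : ∃ w, ‖w‖ ≤ C ∧ WLim (U : Filter ι) z w := by
  have hbd : ∀ g h : H, ∀ i, ‖(inner ℂ g (z i h) : ℂ)‖ ≤ C * ‖g‖ * ‖h‖ := by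
    intro g h i
    calc ‖(inner ℂ g (z i h) : ℂ)‖ ≤ ‖g‖ * ‖z i h‖ := norm_inner_le_norm _ _
      _ ≤ ‖g‖ * (C * ‖h‖) := by
        gcongr
        exact (z i).le_of_opNorm_le (hC i) h
      _ = C * ‖g‖ * ‖h‖ := by ring
  have hex : ∀ g h : H, ∃ c : ℂ, Tendsto (fun i => (inner ℂ g (z i h) : ℂ)) U (𝓝 c) := by
    intro g h
    have := (isCompact_closedBall (0 : ℂ) (C * ‖g‖ * ‖h‖)).ultrafilter_le_nhds
      (U.map (fun i => (inner ℂ g (z i h) : ℂ)))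
      (by
        rw [le_principal_iff]
        refine Filter.mem_map.2 (Filter.Eventually.of_forall (fun i => ?_))
        simpa using hbd g h i)
    obtain ⟨c, -, hc⟩ := this
    exact ⟨c, hc⟩
  choose B hB using hex
  have hBn : ∀ g h, ‖B g h‖ ≤ C * ‖g‖ * ‖h‖ := fun g h =>
    le_of_tendsto (hB g h).norm (Eventually.of_forall (hbd g h))
  let L : H →ₗ⋆[ℂ] H →ₗ[ℂ] ℂ := LinearMap.mk₂'ₛₗ (starRingEnd ℂ) (RingHom.id ℂ) B
    (fun g g' h => tendsto_nhds_unique (hB _ _) (by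
      simpa [inner_add_left] using (hB g h).add (hB g' h)))
    (fun c g h => tendsto_nhds_unique (hB _ _) (by
      simpa [inner_smul_left, mul_comm] using (hB g h).const_mul (starRingEnd ℂ c)))
    (fun g h h' => tendsto_nhds_unique (hB _ _) (by
      simpa [inner_add_right] using (hB g h).add (hB g h')))
    (fun c g h => tendsto_nhds_unique (hB _ _) (by
      simpa [inner_smul_right] using (hB g h).const_mul c))
  let L' := L.mkContinuous₂ C (fun g h => hBn g h)
  let w := adjoint (InnerProductSpace.continuousLinearMapOfBilin L')
  have hw : ∀ g h, inner ℂ g (w h) = B g h := by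
    intro g h
    rw [adjoint_inner_right, InnerProductSpace.continuousLinearMapOfBilin_apply]
    rfl
  have hC0 : 0 ≤ C := by
    obtain ⟨i⟩ := U.neBot.nonempty
    exact (norm_nonneg _).trans (hC i)
  refine ⟨w, ?_, fun g h => by rw [hw]; exact hB g h⟩
  refine opNorm_le_bound _ hC0 (fun h => ?_)
  have h1 := hBn (w h) h
  rw [← hw, inner_self_eq_norm_sq_to_K] at h1
  simp only [Complex.coe_algebraMap, norm_pow, Complex.norm_real, norm_norm] at h1
  by_cases h0 : ‖w h‖ = 0
  · rw [h0]; positivity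
  · have : 0 < ‖w h‖ := lt_of_le_of_ne (norm_nonneg _) (Ne.symm h0)
    nlinarith

theorem WLim.mem {ι : Type*} {l : Filter ι} [l.NeBot] {z : ι → (H →L[ℂ] H)} {w : H →L[ℂ] H}
    (h : WLim l z w) (S : VonNeumannAlgebra H) (hz : ∀ i, z i ∈ S) : w ∈ S := by
  rw [← S.commutant_commutant, VonNeumannAlgebra.mem_commutant_iff]
  intro y hy
  ext v
  refine ext_inner_left ℂ (fun g => ?_)
  have h1 := h (adjoint y g) v
  have h2 := h g (y v)
  change inner ℂ g (y (w v)) = inner ℂ g (w (y v))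
  rw [← adjoint_inner_left]
  refine tendsto_nhds_unique h1 (h2.congr (fun i => ?_))
  rw [adjoint_inner_left]
  exact congrArg (fun T : H →L[ℂ] H => inner ℂ g (T v))
    ((VonNeumannAlgebra.mem_commutant_iff.1 hy) (z i) (hz i))

theorem nonneg_iff_inner (T : H →L[ℂ] H) : 0 ≤ T ↔ ∀ h : H, 0 ≤ (inner ℂ h (T h) : ℂ) := by
  rw [nonneg_iff_isPositive]
  constructor
  · intro hT h; exact hT.inner_nonneg_right h
  · intro hT
    rw [isPositive_iff_complex]
    intro x
    have := hT x
    rw [Complex.nonneg_iff] at this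
    rw [← inner_conj_symm, Complex.conj_eq_iff_im.2 this.2.symm]
    refine ⟨?_, this.1⟩
    apply Complex.ext <;> simp [← this.2]

theorem WLim.const_sub {ι : Type*} {l : Filter ι} {z : ι → (H →L[ℂ] H)} {w : H →L[ℂ] H}
    (h : WLim l z w) (y : H →L[ℂ] H) : WLim l (fun i => y - z i) (y - w) := by
  intro g v
  simpa [inner_sub_right] using (h g v).const_sub (inner ℂ g (y v))

theorem WLim.sub_const {ι : Type*} {l : Filter ι} {z : ι → (H →L[ℂ] H)} {w : H →L[ℂ] H}
    (h : WLim l z w) (y : H →L[ℂ] H) : WLim l (fun i => z i - y) (w - y) := by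
  intro g v
  simpa [inner_sub_right] using (h g v).sub_const (inner ℂ g (y v))

theorem WLim.nonneg {ι : Type*} {l : Filter ι} [l.NeBot] {z : ι → (H →L[ℂ] H)} {w : H →L[ℂ] H}
    (h : WLim l z w) (hz : ∀ᶠ i in l, 0 ≤ z i) : 0 ≤ w := by
  rw [nonneg_iff_inner]
  intro v
  exact ge_of_tendsto (h v v) (hz.mono fun i hi => (nonneg_iff_inner _).1 hi v)

theorem WLim.le {ι : Type*} {l : Filter ι} [l.NeBot] {z : ι → (H →L[ℂ] H)} {w y : H →L[ℂ] H}
    (h : WLim l z w) (hz : ∀ᶠ i in l, z i ≤ y) : w ≤ y :=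
  sub_nonneg.1 ((h.const_sub y).nonneg (hz.mono fun _ hi => sub_nonneg.2 hi))

theorem WLim.ge {ι : Type*} {l : Filter ι} [l.NeBot] {z : ι → (H →L[ℂ] H)} {w y : H →L[ℂ] H}
    (h : WLim l z w) (hz : ∀ᶠ i in l, y ≤ z i) : y ≤ w :=
  sub_nonneg.1 ((h.sub_const y).nonneg (hz.mono fun _ hi => sub_nonneg.2 hi))

theorem WLim.star {ι : Type*} {l : Filter ι} {z : ι → (H →L[ℂ] H)} {w : H →L[ℂ] H}
    (h : WLim l z w) : WLim l (fun i => star (z i)) (star w) := by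
  intro g v
  have := (Complex.continuous_conj.tendsto _).comp (h v g)
  simpa [Function.comp_def, star_eq_adjoint, adjoint_inner_right] using this

theorem cfc_mem (S : VonNeumannAlgebra H) {a : H →L[ℂ] H} (ha : a ∈ S) (f : ℝ → ℝ) :
    cfc f a ∈ S := by
  rw [← S.commutant_commutant, VonNeumannAlgebra.mem_commutant_iff]
  intro y hy
  have : Commute a y := VonNeumannAlgebra.mem_commutant_iff.1 hy a ha
  exact (this.cfc_real f).symm

theorem smul_memV (S : VonNeumannAlgebra H) (c : ℂ) {a : H →L[ℂ] H} (ha : a ∈ S) : c • a ∈ S :=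
  S.toStarSubalgebra.smul_mem ha c

theorem smul_memR (S : VonNeumannAlgebra H) (c : ℝ) {a : H →L[ℂ] H} (ha : a ∈ S) : c • a ∈ S := by
  have := smul_memV S (c : ℂ) ha
  rwa [Complex.coe_smul] at this

/-- a positive element of `S` is `b * b` with `b ∈ S` positive -/
theorem exists_sqrt (S : VonNeumannAlgebra H) {a : H →L[ℂ] H} (ha : a ∈ S) (h0 : 0 ≤ a) :
    ∃ b ∈ S, 0 ≤ b ∧ star b * b = a := by
  refine ⟨cfc (fun x : ℝ => √x) a, cfc_mem S ha _, cfc_nonneg (fun x _ => Real.sqrt_nonneg x), ?_⟩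
  have hb : IsSelfAdjoint (cfc (fun x : ℝ => √x) a) := cfc_predicate _ _
  rw [hb.star_eq, ← cfc_mul ..]
  conv_rhs => rw [← cfc_id' ℝ a]
  exact cfc_congr (fun x hx => Real.mul_self_sqrt (spectrum_nonneg_of_nonneg h0 hx))

end CD

end

section
open scoped Classical ComplexOrder
set_option linter.unusedSectionVars false
namespace CD
open Filter Topology ContinuousLinearMap
variable {H : Type} [NormedAddCommGroup H] [InnerProductSpace ℂ H] [CompleteSpace H]
variable {M : VonNeumannAlgebra H} (tr : TraceOn H (M : Set (H →L[ℂ] H)))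

theorem tau_nonneg {a : H →L[ℂ] H} (ha : a ∈ M) (h0 : 0 ≤ a) : 0 ≤ (tr.τ a).re := by
  obtain ⟨b, hb, -, rfl⟩ := exists_sqrt M ha h0
  exact (tr.nonneg b hb).1

theorem tau_mono {a b : H →L[ℂ] H} (ha : a ∈ M) (hb : b ∈ M) (h : a ≤ b) :
    (tr.τ a).re ≤ (tr.τ b).re := by
  have := tau_nonneg tr (sub_mem hb ha) (sub_nonneg.2 h)
  rw [map_sub, Complex.sub_re] at this
  linarith

theorem tau_pos {a : H →L[ℂ] H} (ha : a ∈ M) (h0 : 0 ≤ a) (hne : a ≠ 0) : 0 < (tr.τ a).re := by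
  refine lt_of_le_of_ne (tau_nonneg tr ha h0) (fun h => hne ?_)
  obtain ⟨b, hb, -, rfl⟩ := exists_sqrt M ha h0
  have : b = 0 := tr.faithful b hb (Complex.ext h.symm (tr.nonneg b hb).2)
  simp [this]

/-- the pre-inner product on `M` given by the trace -/
def preCore : PreInnerProductSpace.Core ℂ M.toStarSubalgebra where
  inner y x := tr.τ (star (y : H →L[ℂ] H) * x)
  conj_inner_symm x y := by
    rw [← tr.star_eq _ (mul_mem (star_mem (show (y : H →L[ℂ] H) ∈ M from y.2))
      (show (x : H →L[ℂ] H) ∈ M from x.2))]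
    simp
  re_inner_nonneg x := (tr.nonneg _ x.2).1
  add_left x y z := by simp [add_mul]
  smul_left x y r := by simp

theorem cauchy_schwarz {x y : H →L[ℂ] H} (hx : x ∈ M) (hy : y ∈ M) :
    ‖tr.τ (star y * x)‖ ^ 2 ≤ (tr.τ (star y * y)).re * (tr.τ (star x * x)).re := by
  letI := preCore tr
  have h := InnerProductSpace.Core.inner_mul_inner_self_le (𝕜 := ℂ)
    (⟨y, hy⟩ : M.toStarSubalgebra) ⟨x, hx⟩
  have e : tr.τ (star x * y) = starRingEnd ℂ (tr.τ (star y * x)) := by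
    rw [← tr.star_eq _ (mul_mem (star_mem hy) hx)]
    simp
  change ‖tr.τ (star y * x)‖ * ‖tr.τ (star x * y)‖ ≤ _ at h
  rw [e, RCLike.norm_conj, ← sq] at h
  exact h

/-- `h` is dominated by finitely many vectors. -/
def Good (h : H →L[ℂ] H) : Prop :=
  ∃ (ι : Type) (_ : Fintype ι) (ζ : ι → H), ∀ x ∈ M,
    (tr.τ (x * h * star x)).re ≤ ∑ i, ‖x (ζ i)‖ ^ 2

variable {tr}

theorem Good.add {h k : H →L[ℂ] H} (hh : Good tr h) (hk : Good tr k) : Good tr (h + k) := by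
  obtain ⟨ι, _, ζ, hζ⟩ := hh
  obtain ⟨κ, _, η, hη⟩ := hk
  refine ⟨ι ⊕ κ, inferInstance, Sum.elim ζ η, fun x hx => ?_⟩
  rw [mul_add, add_mul, map_add, Complex.add_re, Fintype.sum_sum_type]
  exact add_le_add (hζ x hx) (hη x hx)

theorem Good.conj {h b : H →L[ℂ] H} (hh : Good tr h) (hb : b ∈ M) : Good tr (b * h * star b) := by
  obtain ⟨ι, _, ζ, hζ⟩ := hh
  refine ⟨ι, inferInstance, fun i => b (ζ i), fun x hx => ?_⟩
  have := hζ (x * b) (mul_mem hx hb)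
  simpa [mul_assoc] using this

theorem Good.of_le {h k : H →L[ℂ] H} (hh : Good tr h) (hM : h ∈ M) (kM : k ∈ M) (C : ℝ)
    (hC : 0 ≤ C) (hk : k ≤ C • h) : Good tr k := by
  obtain ⟨ι, _, ζ, hζ⟩ := hh
  refine ⟨ι, inferInstance, fun i => (√C : ℂ) • (ζ i), fun x hx => ?_⟩
  have h1 : x * k * star x ≤ x * (C • h) * star x := star_right_conjugate_le_conjugate hk x
  have h2 := tau_mono tr (mul_mem (mul_mem hx kM) (star_mem hx))
    (mul_mem (mul_mem hx (smul_memR M C hM)) (star_mem hx)) h1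
  have h3 : (tr.τ (x * (C • h) * star x)).re = C * (tr.τ (x * h * star x)).re := by
    rw [mul_smul_comm, smul_mul_assoc, ← Complex.coe_smul, map_smul]
    simp
  rw [h3] at h2
  refine h2.trans ?_
  have h4 : ∀ i, ‖x ((√C : ℂ) • ζ i)‖ ^ 2 = C * ‖x (ζ i)‖ ^ 2 := by
    intro i
    rw [map_smul, norm_smul, mul_pow]
    congr 1
    simp [Real.sq_sqrt hC]
  simp_rw [h4, ← Finset.mul_sum]
  exact mul_le_mul_of_nonneg_left (hζ x hx) hC

variable (tr)

theorem sq_le_self' {r : H →L[ℂ] H} (h0 : 0 ≤ r) (h1 : r ≤ 1) : r * r ≤ r := by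
  have hr : star r = r := (IsSelfAdjoint.of_nonneg h0).star_eq
  have hr' : star (1 - r) = 1 - r := by simp [hr]
  have a : 0 ≤ r * (1 - r) * star r := star_right_conjugate_nonneg (sub_nonneg.2 h1) r
  have b : 0 ≤ (1 - r) * r * star (1 - r) := star_right_conjugate_nonneg h0 (1 - r)
  rw [hr] at a
  rw [hr'] at b
  rw [← sub_nonneg]
  have : r - r * r = r * (1 - r) * r + (1 - r) * r * (1 - r) := by noncomm_ring
  rw [this]
  exact add_nonneg a b

theorem star_mul_self_le_one {x : H →L[ℂ] H} (hx : ‖x‖ ≤ 1) : star x * x ≤ 1 := by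
  have h1 : ‖star x * x‖ ≤ 1 := by
    rw [CStarRing.norm_star_mul_self]
    nlinarith [norm_nonneg x]
  exact (CStarAlgebra.norm_le_one_iff_of_nonneg _ (star_mul_self_nonneg x)).1 h1

theorem inner_star_mul (x : H →L[ℂ] H) (v : H) :
    (inner ℂ v ((star x * x) v) : ℂ).re = ‖x v‖ ^ 2 := by
  change (inner ℂ v ((adjoint x) (x v)) : ℂ).re = _
  rw [adjoint_inner_right]
  exact inner_self_eq_norm_sq (𝕜 := ℂ) (x v)

theorem exists_good : ∃ g ∈ M, 0 ≤ g ∧ g ≠ 0 ∧ Good tr g := by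
  have hne : ∃ ξ : H, ‖ξ‖ ^ 2 = 2 := by
    have : ∃ v : H, v ≠ 0 := by
      by_contra hcon
      push Not at hcon
      have h1 : (1 : H →L[ℂ] H) = 0 := by
        ext v; simp [hcon v]
      have := tr.unital
      rw [h1, map_zero] at this
      exact zero_ne_one this
    obtain ⟨v, hv⟩ := this
    have hv' : ‖v‖ ≠ 0 := norm_ne_zero_iff.2 hv
    refine ⟨((√2 / ‖v‖ : ℝ) : ℂ) • v, ?_⟩
    rw [norm_smul, Complex.norm_real, norm_div, norm_norm, div_mul_cancel₀ _ hv']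
    simp
  obtain ⟨ξ, hξ⟩ := hne
  let φ : (H →L[ℂ] H) → ℝ := fun y => (inner ℂ ξ (y ξ) : ℂ).re
  have φadd : ∀ a b, φ (a + b) = φ a + φ b := fun a b => by
    simp [φ, inner_add_right]
  let D : Set (H →L[ℂ] H) := {y | y ∈ M ∧ 0 ≤ y ∧ y ≤ 1 ∧ φ y ≤ (tr.τ y).re}
  have hD0 : (0 : H →L[ℂ] H) ∈ D := ⟨zero_mem M, le_rfl, zero_le_one, by simp [φ]⟩
  obtain ⟨y, -, hy⟩ := zorn_le_nonempty₀ D (by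
    intro c hcD hc z hz
    haveI : Nonempty c := ⟨⟨z, hz⟩⟩
    haveI : IsDirectedOrder c := ⟨fun a b => by
      rcases hc.total a.2 b.2 with h | h
      · exact ⟨b, h, le_rfl⟩
      · exact ⟨a, le_rfl, h⟩⟩
    let U : Ultrafilter c := Ultrafilter.of atTop
    have hU : (U : Filter c) ≤ atTop := Ultrafilter.of_le _
    obtain ⟨w, -, hw⟩ := exists_wlim U (fun i : c => (i : H →L[ℂ] H)) 1 (fun i =>
      (CStarAlgebra.norm_le_one_iff_of_nonneg _ (hcD i.2).2.1).2 (hcD i.2).2.2.1)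
    have hwM : w ∈ M := hw.mem M (fun i => (hcD i.2).1)
    have hle : ∀ i : c, (i : H →L[ℂ] H) ≤ w := fun i =>
      hw.ge (hU ((eventually_ge_atTop i).mono fun j hj => hj))
    refine ⟨w, ⟨hwM, hw.nonneg (Eventually.of_forall fun i => (hcD i.2).2.1),
      hw.le (Eventually.of_forall fun i => (hcD i.2).2.2.1), ?_⟩, fun i hi => hle ⟨i, hi⟩⟩
    refine le_of_tendsto ((Complex.continuous_re.tendsto _).comp (hw ξ ξ))
      (Eventually.of_forall fun i => ?_)
    exact (hcD i.2).2.2.2.trans (tau_mono tr (hcD i.2).1 hwM (hle i))) 0 hD0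
  obtain ⟨⟨hyM, hy0, hy1, hyφ⟩, hmax⟩ := hy
  set r := 1 - y with hr
  have hrM : r ∈ M := sub_mem (one_mem M) hyM
  have hr0 : 0 ≤ r := sub_nonneg.2 hy1
  have hr1 : r ≤ 1 := by rw [hr]; exact sub_le_self _ hy0
  have hrs : star r = r := (IsSelfAdjoint.of_nonneg hr0).star_eq
  have hrne : r ≠ 0 := by
    intro h
    have : y = 1 := (sub_eq_zero.1 h).symm
    rw [this, tr.unital] at hyφ
    have h2 : φ 1 = 2 := by
      have := inner_self_eq_norm_sq (𝕜 := ℂ) ξ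
      rw [hξ] at this
      exact this
    rw [h2] at hyφ
    norm_num at hyφ
  have key : ∀ z ∈ M, 0 ≤ z → z ≤ r → (tr.τ z).re ≤ φ z := by
    intro z hz hz0 hzr
    by_contra hcon
    push Not at hcon
    have hmem : y + z ∈ D := ⟨add_mem hyM hz, add_nonneg hy0 hz0, by
      calc y + z ≤ y + r := by gcongr
        _ = 1 := by rw [hr]; abel, by
      rw [φadd, map_add, Complex.add_re]; linarith⟩
    have h1 := hmax hmem (le_add_of_nonneg_right hz0)
    have h2 : z ≤ 0 := by simpa using h1
    have h3 : z = 0 := le_antisymm h2 hz0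
    rw [h3] at hcon
    simp [φ] at hcon
  refine ⟨r * r, mul_mem hrM hrM, ?_, ?_, Unit, inferInstance, fun _ => r ξ, ?_⟩
  · have := star_mul_self_nonneg r
    rwa [hrs] at this
  · intro h
    apply hrne
    have : star r * r = 0 := by rw [hrs]; exact h
    exact (CStarRing.star_mul_self_eq_zero_iff r).1 this
  have small : ∀ x ∈ M, ‖x‖ ≤ 1 → (tr.τ (x * (r * r) * star x)).re ≤ ‖x (r ξ)‖ ^ 2 := by
    intro x hx hxn
    have h1 : star r * (star x * x) * r ≤ r := by
      have := star_left_conjugate_le_conjugate (star_mul_self_le_one hxn) r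
      refine this.trans ?_
      rw [mul_one, hrs]
      exact sq_le_self' hr0 hr1
    have h2 : star r * (star x * x) * r = star (x * r) * (x * r) := by simp [mul_assoc]
    have h3 := key (star (x * r) * (x * r)) (mul_mem (star_mem (mul_mem hx hrM)) (mul_mem hx hrM))
      (star_mul_self_nonneg _) (h2 ▸ h1)
    have h4 : φ (star (x * r) * (x * r)) = ‖x (r ξ)‖ ^ 2 := inner_star_mul (x * r) ξ
    rw [h4] at h3
    rw [tr.tracial _ (star_mem (mul_mem hx hrM)) _ (mul_mem hx hrM)] at h3
    have h5 : x * r * star (x * r) = x * (r * r) * star x := by simp [mul_assoc, hrs]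
    rwa [h5] at h3
  intro x hx
  simp only [Finset.univ_unique, Finset.sum_singleton]
  by_cases hx0 : ‖x‖ = 0
  · have : x = 0 := norm_eq_zero.1 hx0
    simp [this]
  · have hpos : 0 < ‖x‖ := lt_of_le_of_ne (norm_nonneg _) (Ne.symm hx0)
    have := small (((‖x‖⁻¹ : ℝ) : ℂ) • x) (smul_memV M _ hx) (by
      rw [norm_smul]; simp [hx0])
    rw [star_smul, smul_mul_assoc, smul_mul_assoc, mul_smul_comm, map_smul, map_smul, smul_apply,
      norm_smul] at this
    simp only [smul_eq_mul, Complex.star_def, Complex.conj_ofReal, Complex.re_ofReal_mul,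
      Complex.norm_real, norm_inv, norm_norm, mul_pow] at this
    have hi : 0 < ‖x‖⁻¹ := inv_pos.2 hpos
    rw [← mul_assoc, ← sq] at this
    exact le_of_mul_le_mul_left this (by positivity)

end CD

end

section
open scoped Classical ComplexOrder
set_option linter.unusedSectionVars false
namespace CD
open Filter Topology ContinuousLinearMap
variable {H : Type} [NormedAddCommGroup H] [InnerProductSpace ℂ H] [CompleteSpace H]
variable {M : VonNeumannAlgebra H} (tr : TraceOn H (M : Set (H →L[ℂ] H)))

theorem exists_proj_range (S : VonNeumannAlgebra H) (W : Submodule ℂ H)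
    (hW : ∀ y ∈ S.commutant, ∀ w ∈ W, y w ∈ W) :
    ∃ p ∈ S, star p = p ∧ p * p = p ∧ (∀ w ∈ W, p w = w) ∧
      ∀ v, p v ∈ closure (W : Set H) := by
  have : CompleteSpace W.topologicalClosure :=
    (W.isClosed_topologicalClosure).completeSpace_coe
  have hs : IsStarProjection W.topologicalClosure.starProjection := isStarProjection_starProjection
  refine ⟨W.topologicalClosure.starProjection, ?_, hs.isSelfAdjoint.star_eq,
    hs.isIdempotentElem.eq, ?_, ?_⟩
  · rw [VonNeumannAlgebra.IsStarProjection.mem_iff hs]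
    intro y hy
    rw [Submodule.range_starProjection]
    intro v hv
    change y v ∈ W.topologicalClosure
    have hv' : v ∈ closure (W : Set H) := hv
    have := map_mem_closure (t := (W : Set H)) y.continuous hv' (fun w hw => hW y hy w hw)
    exact this
  · intro w hw
    exact Submodule.starProjection_eq_self_iff.2 (W.le_topologicalClosure hw)
  · intro v
    exact Submodule.starProjection_apply_mem W.topologicalClosure v

theorem exists_good_proj : ∃ p ∈ M, star p = p ∧ p * p = p ∧ p ≠ 0 ∧ Good tr p := by
  obtain ⟨g, gM, g0, gne, hg⟩ := exists_good tr
  have gsa : IsSelfAdjoint g := IsSelfAdjoint.of_nonneg g0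
  set ε : ℝ := ‖g‖ / 2 with hε
  have hgn : 0 < ‖g‖ := norm_pos_iff.2 gne
  have εpos : 0 < ε := by positivity
  set b := cfc (fun t : ℝ => max (t - ε) 0) g with hb
  have bM : b ∈ M := cfc_mem M gM _
  have b0 : 0 ≤ b := cfc_nonneg (fun t _ => le_max_right _ _)
  have bsa : star b = b := (IsSelfAdjoint.of_nonneg b0).star_eq
  have e1 : cfc (fun t : ℝ => t - ε) g = g - ε • 1 := by
    rw [cfc_sub (R := ℝ) (fun t => t) (fun _ => ε) g, cfc_id' ℝ g, cfc_const ε g,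
      Algebra.algebraMap_eq_smul_one]
  have e2 : (g - ε • 1) * b = b * b := by
    rw [← e1, hb, ← cfc_mul (R := ℝ) _ _ g, ← cfc_mul (R := ℝ) _ _ g]
    congr 1
    ext t
    rcases le_total (t - ε) 0 with h | h
    · simp [max_eq_right h]
    · simp [max_eq_left h]
  have bne : b ≠ 0 := by
    intro h0
    have : g - ε • 1 ≤ b := by
      rw [← e1, hb]
      exact cfc_mono (fun t _ => le_max_left _ _)
    rw [h0, sub_nonpos] at this
    have h2 : ‖g‖ ≤ ε := (CStarAlgebra.norm_le_iff_le_algebraMap g εpos.le g0).2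
      (by rwa [Algebra.algebraMap_eq_smul_one])
    linarith
  obtain ⟨p, pM, psa, pp, pfix, pcl⟩ := exists_proj_range M (LinearMap.range (b : H →ₗ[ℂ] H)) (by
    rintro y hy _ ⟨v, rfl⟩
    rw [VonNeumannAlgebra.mem_commutant_iff] at hy
    refine ⟨y v, ?_⟩
    exact DFunLike.congr_fun (hy b bM) v)
  refine ⟨p, pM, psa, pp, ?_, ?_⟩
  · rintro rfl
    apply bne
    ext v
    exact (pfix (b v) ⟨v, rfl⟩).symm
  · refine Good.of_le (hg.conj pM) (mul_mem (mul_mem pM gM) (star_mem pM)) pM ε⁻¹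
      (by positivity) ?_
    have key : ε • p ≤ p * g * p := by
      rw [← sub_nonneg, nonneg_iff_inner]
      have h1 : p * g * p - ε • p = star p * (g - ε • 1) * p := by
        rw [psa, mul_sub, sub_mul, mul_smul_comm, smul_mul_assoc, mul_one, pp]
      intro v
      rw [h1]
      change 0 ≤ (inner ℂ v ((adjoint p) ((g - ε • (1 : H →L[ℂ] H)) (p v))) : ℂ)
      rw [adjoint_inner_right]
      have hcl : IsClosed {w : H | 0 ≤ (inner ℂ w ((g - ε • (1 : H →L[ℂ] H)) w) : ℂ)} := by
        refine isClosed_le continuous_const ?_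
        exact continuous_id.inner (g - ε • (1 : H →L[ℂ] H)).continuous
      refine closure_minimal ?_ hcl (pcl v)
      rintro _ ⟨w, rfl⟩
      have h3 : 0 ≤ star b * b * b := star_left_conjugate_nonneg b0 b
      have h4 : star b * b * b = star b * ((g - ε • (1 : H →L[ℂ] H)) * b) := by
        rw [e2, mul_assoc]
      rw [h4, nonneg_iff_inner] at h3
      have h5 := h3 w
      change 0 ≤ (inner ℂ w ((adjoint b) ((g - ε • (1 : H →L[ℂ] H)) (b w))) : ℂ) at h5
      rw [adjoint_inner_right] at h5
      exact h5
    rw [psa]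
    have h6 : ε⁻¹ • (ε • p) ≤ ε⁻¹ • (p * g * p) := smul_le_smul_of_nonneg_left key (by positivity)
    rwa [smul_smul, inv_mul_cancel₀ εpos.ne', one_smul] at h6

theorem factor_conn (hfac : ∀ z ∈ M, (∀ y ∈ M, z * y = y * z) → ∃ c : ℂ, z = c • (1 : H →L[ℂ] H))
    {p q : H →L[ℂ] H} (pM : p ∈ M) (qM : q ∈ M) (h : ∀ x ∈ M, p * x * q = 0) : p = 0 ∨ q = 0 := by
  by_contra hcon
  push Not at hcon
  obtain ⟨hp, hq⟩ := hcon
  set W : Submodule ℂ H := Submodule.span ℂ {v | ∃ x ∈ M, ∃ h, v = x (q h)} with hWdef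
  have h1 : ∀ y ∈ M.commutant, ∀ w ∈ W, y w ∈ W := by
    intro y hy w hw
    rw [VonNeumannAlgebra.mem_commutant_iff] at hy
    induction hw using Submodule.span_induction with
    | mem v hv =>
      obtain ⟨x, hx, h, rfl⟩ := hv
      refine Submodule.subset_span ⟨x, hx, y h, ?_⟩
      have := DFunLike.congr_fun (hy (x * q) (mul_mem hx qM)) h
      exact this.symm
    | zero => simp
    | add a b _ _ ha hb => rw [map_add]; exact add_mem ha hb
    | smul c a _ ha => rw [map_smul]; exact W.smul_mem c ha
  have h2 : ∀ y ∈ M, ∀ w ∈ W, y w ∈ W := by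
    intro y hy w hw
    induction hw using Submodule.span_induction with
    | mem v hv =>
      obtain ⟨x, hx, h, rfl⟩ := hv
      exact Submodule.subset_span ⟨y * x, mul_mem hy hx, h, rfl⟩
    | zero => simp
    | add a b _ _ ha hb => rw [map_add]; exact add_mem ha hb
    | smul c a _ ha => rw [map_smul]; exact W.smul_mem c ha
  obtain ⟨z, zM, zsa, zz, zfix, zcl⟩ := exists_proj_range M W h1
  have hcomm : ∀ y ∈ M, z * y * z = y * z := by
    intro y hy
    ext v
    have hcl : IsClosed {w : H | z (y w) = y w} :=
      isClosed_eq (z.continuous.comp y.continuous) y.continuous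
    exact closure_minimal (fun w hw => zfix _ (h2 y hy w hw)) hcl (zcl v)
  have hcomm' : ∀ y ∈ M, z * y = y * z := by
    intro y hy
    have a := hcomm y hy
    have b := congrArg star (hcomm (star y) (star_mem hy))
    simp only [star_mul, star_star, zsa] at b
    exact b.symm.trans ((mul_assoc z y z).symm.trans a)
  obtain ⟨c, hc⟩ := hfac z zM hcomm'
  have : ∃ h, q h ≠ 0 := by
    by_contra hh
    push Not at hh
    exact hq (by ext v; simpa using hh v)
  obtain ⟨h0, hh0⟩ := this
  have hz : z (q h0) = q h0 := zfix _ (Submodule.subset_span ⟨1, one_mem M, h0, rfl⟩)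
  have hc1 : c = 1 := by
    rw [hc] at hz
    have : c • q h0 = (1 : ℂ) • q h0 := by simpa using hz
    exact smul_left_injective ℂ hh0 this
  rw [hc1, one_smul] at hc
  apply hp
  ext v
  have hv : v ∈ closure (W : Set H) := by
    have := zcl v
    rwa [hc] at this
  have hcl : IsClosed {w : H | p w = 0} := isClosed_eq p.continuous continuous_const
  refine closure_minimal ?_ hcl hv
  intro w hw
  change p w = 0
  induction hw using Submodule.span_induction with
  | mem v hv =>
    obtain ⟨x, hx, k, rfl⟩ := hv
    exact DFunLike.congr_fun (h x hx) k
  | zero => simp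
  | add a b _ _ ha hb => rw [map_add, ha, hb, add_zero]
  | smul c a _ ha => rw [map_smul, ha, smul_zero]

end CD

end

section
open scoped Classical ComplexOrder
set_option linter.unusedSectionVars false
namespace CD
open Filter Topology ContinuousLinearMap
variable {H : Type} [NormedAddCommGroup H] [InnerProductSpace ℂ H] [CompleteSpace H]
variable {M : VonNeumannAlgebra H} (tr : TraceOn H (M : Set (H →L[ℂ] H)))

/-- matrix coefficients of an operator -/
def coefs (x : H →L[ℂ] H) : H × H → ℂ := fun gh => inner ℂ gh.1 (x gh.2)

theorem coefs_injective : Function.Injective (coefs : (H →L[ℂ] H) → (H × H → ℂ)) := by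
  intro x y h
  ext v
  exact ext_inner_left ℂ (fun w => congrFun h (w, v))

theorem exists_extreme (S : Set (H →L[ℂ] H)) (hb : ∀ x ∈ S, ‖x‖ ≤ 1) (hne : S.Nonempty)
    (hcl : ∀ (ι : Type) (U : Ultrafilter ι) (z : ι → (H →L[ℂ] H)) (w : H →L[ℂ] H),
      (∀ i, z i ∈ S) → ‖w‖ ≤ 1 → WLim (U : Filter ι) z w → w ∈ S) :
    ∃ v ∈ S, ∀ x, v + x ∈ S → v - x ∈ S → x = 0 := by
  have hcomp : IsCompact (coefs '' S) := by
    rw [isCompact_iff_ultrafilter_le_nhds']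
    intro f hf
    obtain ⟨x0, hx0⟩ := hne
    have hz : ∀ φ : H × H → ℂ, ∃ z ∈ S, φ ∈ coefs '' S → coefs z = φ := by
      intro φ
      by_cases h : φ ∈ coefs '' S
      · obtain ⟨z, hz, e⟩ := h
        exact ⟨z, hz, fun _ => e⟩
      · exact ⟨x0, hx0, fun h' => absurd h' h⟩
    choose z hzS hz using hz
    obtain ⟨w, hw1, hw⟩ := exists_wlim f z 1 (fun i => hb _ (hzS i))
    refine ⟨coefs w, ⟨w, hcl _ f z w hzS hw1 hw, rfl⟩, ?_⟩
    have : Tendsto (fun φ : H × H → ℂ => φ) (f : Filter (H × H → ℂ)) (𝓝 (coefs w)) := by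
      rw [tendsto_pi_nhds]
      rintro ⟨g, h⟩
      refine (hw g h).congr' ?_
      filter_upwards [hf] with φ hφ
      exact congrFun (hz φ hφ) (g, h)
    exact this
  obtain ⟨_, ⟨⟨v, hv, rfl⟩, hext⟩⟩ := hcomp.extremePoints_nonempty (hne.image _)
  refine ⟨v, hv, fun x hp hm => ?_⟩
  have := hext ⟨_, hp, rfl⟩ ⟨_, hm, rfl⟩ ?_
  · have := coefs_injective this
    simpa using this
  · refine ⟨1/2, 1/2, by norm_num, by norm_num, by norm_num, ?_⟩
    funext gh
    simp only [coefs, Pi.add_apply, Pi.smul_apply, add_apply, sub_apply, inner_add_right,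
      inner_sub_right, Complex.real_smul]
    push_cast
    ring

theorem norm_le_one_of {x : H →L[ℂ] H} (h : star x * x ≤ 1) : ‖x‖ ≤ 1 := by
  have h1 := (CStarAlgebra.norm_le_one_iff_of_nonneg _ (star_mul_self_nonneg x)).2 h
  rw [CStarRing.norm_star_mul_self] at h1
  nlinarith [norm_nonneg x]

theorem proj_nonneg {p : H →L[ℂ] H} (psa : star p = p) (pp : p * p = p) : 0 ≤ p := by
  have := star_mul_self_nonneg p
  rwa [psa, pp] at this

theorem proj_le_one {p : H →L[ℂ] H} (psa : star p = p) (pp : p * p = p) : p ≤ 1 := by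
  rw [← sub_nonneg]
  refine proj_nonneg (by simp [psa]) ?_
  simp [mul_sub, sub_mul, pp]

set_option maxHeartbeats 1000000 in
theorem compare (hfac : ∀ z ∈ M, (∀ y ∈ M, z * y = y * z) → ∃ c : ℂ, z = c • (1 : H →L[ℂ] H))
    {p r : H →L[ℂ] H} (pM : p ∈ M) (psa : star p = p) (pp : p * p = p)
    (rM : r ∈ M) (rsa : star r = r) (rr : r * r = r) :
    ∃ v ∈ M, r * v = v ∧ v * p = v ∧ v * star v * v = v ∧
      (v * star v = r ∨ star v * v = p) := by
  obtain ⟨v, ⟨vM, v1, hv⟩, hext⟩ := exists_extreme {x | x ∈ M ∧ ‖x‖ ≤ 1 ∧ r * x * p = x}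
    (fun x hx => hx.2.1) ⟨0, zero_mem M, by simp, by simp⟩ (by
      intro ι U z w hz hw1 hw
      refine ⟨hw.mem M (fun i => (hz i).1), hw1, ?_⟩
      ext h
      refine ext_inner_left ℂ (fun g => ?_)
      have h1 := hw g h
      have h2 := hw ((adjoint r) g) (p h)
      refine tendsto_nhds_unique ?_ h1
      change Tendsto _ _ (𝓝 (inner ℂ g (r (w (p h)))))
      rw [← adjoint_inner_left]
      refine h2.congr (fun i => ?_)
      rw [adjoint_inner_left]
      exact congrArg (fun T : H →L[ℂ] H => (inner ℂ g (T h) : ℂ)) (hz i).2.2)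
  have rv : r * v = v := by
    rw [← hv, ← mul_assoc, ← mul_assoc, rr]
  have vp : v * p = v := by
    rw [← hv, mul_assoc, pp]
  have vr : star v * r = star v := by
    have := congrArg star rv
    rwa [star_mul, rsa] at this
  have pv : p * star v = star v := by
    have := congrArg star vp
    rwa [star_mul, psa] at this
  have vvv : v * star v * v = v := by
    obtain ⟨s, hs⟩ : ∃ s, s = 1 - star v * v := ⟨_, rfl⟩
    have ssa : star s = s := by simp [hs]
    have s0 : 0 ≤ s := by rw [hs]; exact sub_nonneg.2 (star_mul_self_le_one v1)
    have s1 : s ≤ 1 := by rw [hs]; exact sub_le_self _ (star_mul_self_nonneg v)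
    have sM : s ∈ M := by rw [hs]; exact sub_mem (one_mem M) (mul_mem (star_mem vM) vM)
    have hmem : ∀ y ∈ M, y = v * s → r * y * p = y := by
      rintro y - rfl
      rw [hs, mul_sub, mul_one, mul_sub, sub_mul, hv, ← mul_assoc, ← mul_assoc, rv,
        mul_assoc _ v p, vp, mul_assoc]
    have h1 := hmem _ (mul_mem vM sM) rfl
    have h0 := hext ((1/2 : ℝ) • (v * s)) ?_ ?_
    · have : v * s = 0 := by simpa using h0
      rw [hs, mul_sub, mul_one, sub_eq_zero, ← mul_assoc] at this
      exact this.symm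
    · refine ⟨add_mem vM (smul_memR M _ (mul_mem vM sM)), ?_, ?_⟩
      · apply norm_le_one_of
        have e : star (v + (1/2:ℝ) • (v * s)) * (v + (1/2:ℝ) • (v * s)) =
            1 - star s * ((3/4 : ℝ) • 1 + (1/4 : ℝ) • s) * s := by
          have ev : star v * v = 1 - s := by simp [hs]
          have e1 : v + (1/2:ℝ) • (v * s) = v * (1 + (1/2:ℝ) • s) := by
            rw [mul_add, mul_one, mul_smul_comm]
          rw [e1, star_mul, mul_assoc, ← mul_assoc (star v), ev]
          simp only [star_add, star_one, star_smul, ssa, star_trivial]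
          simp only [mul_add, add_mul, mul_sub, sub_mul, mul_one, one_mul, smul_mul_assoc,
            mul_smul_comm, smul_add, smul_sub, smul_smul, mul_assoc]
          module
        rw [e]
        refine sub_le_self _ (star_left_conjugate_nonneg ?_ s)
        exact add_nonneg (smul_nonneg (by norm_num) zero_le_one) (smul_nonneg (by norm_num) s0)
      · rw [mul_add, add_mul, hv, mul_smul_comm, smul_mul_assoc, h1]
    · refine ⟨sub_mem vM (smul_memR M _ (mul_mem vM sM)), ?_, ?_⟩
      · have e1 : v - (1/2:ℝ) • (v * s) = v * (1 - (1/2:ℝ) • s) := by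
          rw [mul_sub, mul_one, mul_smul_comm]
        rw [e1]
        refine (norm_mul_le _ _).trans (mul_le_one₀ v1 (norm_nonneg _) ?_)
        have hh : (1/2:ℝ) • s ≤ 1 := by
          refine le_trans ?_ s1
          have := smul_le_smul_of_nonneg_right (show (1/2:ℝ) ≤ 1 by norm_num) s0
          rwa [one_smul] at this
        refine (CStarAlgebra.norm_le_one_iff_of_nonneg _ (sub_nonneg.2 hh)).2 ?_
        exact sub_le_self _ (smul_nonneg (by norm_num) s0)
      · rw [mul_sub, sub_mul, hv, mul_smul_comm, smul_mul_assoc, h1]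
  refine ⟨v, vM, rv, vp, vvv, ?_⟩
  obtain ⟨f, hf⟩ : ∃ f, f = p - star v * v := ⟨_, rfl⟩
  obtain ⟨e, he⟩ : ∃ e, e = r - v * star v := ⟨_, rfl⟩
  have vvv' : star v * v * star v = star v := by
    have := congrArg star vvv
    simpa [mul_assoc] using this
  have fsa : star f = f := by simp [hf, psa]
  have ff : f * f = f := by
    rw [hf, mul_sub, sub_mul, sub_mul, pp, ← mul_assoc p, pv, mul_assoc _ v p, vp,
      ← mul_assoc, vvv']
    simp
  have re : r * e = e := by
    rw [he, mul_sub, rr, ← mul_assoc, rv]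
  have fp : f * p = f := by
    rw [hf, sub_mul, pp, mul_assoc, vp]
  have ve : star v * e = 0 := by
    rw [he, mul_sub, vr, ← mul_assoc, vvv', sub_self]
  have eM : e ∈ M := by rw [he]; exact sub_mem rM (mul_mem vM (star_mem vM))
  have fM : f ∈ M := by rw [hf]; exact sub_mem pM (mul_mem (star_mem vM) vM)
  have key : ∀ x ∈ M, e * x * f = 0 := by
    intro x hx
    obtain ⟨c, hc⟩ : ∃ c : ℝ, c = (‖e * x * f‖ + 1)⁻¹ := ⟨_, rfl⟩
    have hc0 : 0 < c := by rw [hc]; positivity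
    obtain ⟨y, hy⟩ : ∃ y, y = c • (e * x * f) := ⟨_, rfl⟩
    have yM : y ∈ M := by rw [hy]; exact smul_memR M _ (mul_mem (mul_mem eM hx) fM)
    have y1 : ‖y‖ ≤ 1 := by
      rw [hy, norm_smul, Real.norm_of_nonneg hc0.le, hc, inv_mul_le_one₀ (by positivity)]
      linarith
    have ry : r * y = y := by
      rw [hy, mul_smul_comm, ← mul_assoc, ← mul_assoc, re]
    have yp : y * p = y := by
      rw [hy, smul_mul_assoc, mul_assoc, fp]
    have yf : y * f = y := by
      rw [hy, smul_mul_assoc, mul_assoc, ff]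
    have fy : f * star y = star y := by
      have := congrArg star yf
      rwa [star_mul, fsa] at this
    have vy : star v * y = 0 := by
      rw [hy, mul_smul_comm, ← mul_assoc, ← mul_assoc, ve]; simp
    have yv : star y * v = 0 := by
      have := congrArg star vy
      simpa using this
    have hyy : star y * y ≤ f := by
      have h1 := star_left_conjugate_le_conjugate (star_mul_self_le_one y1) f
      rw [fsa, mul_one, ff, ← mul_assoc, fy, mul_assoc, yf] at h1
      exact h1
    have hle : star v * v + star y * y ≤ 1 := by
      calc star v * v + star y * y ≤ star v * v + f := by gcongr
        _ = p := by rw [hf]; abel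
        _ ≤ 1 := proj_le_one psa pp
    have hy0 : y = 0 := by
      refine hext y ⟨add_mem vM yM, norm_le_one_of ?_, ?_⟩ ⟨sub_mem vM yM, norm_le_one_of ?_, ?_⟩
      · have : star (v + y) * (v + y) = star v * v + star y * y := by
          rw [star_add, mul_add, add_mul, add_mul, vy, yv]; abel
        rwa [this]
      · rw [mul_add, add_mul, hv, ry, yp]
      · have : star (v - y) * (v - y) = star v * v + star y * y := by
          rw [star_sub, mul_sub, sub_mul, sub_mul, vy, yv]; abel
        rwa [this]
      · rw [mul_sub, sub_mul, hv, ry, yp]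
    rw [hy, smul_eq_zero] at hy0
    exact hy0.resolve_left hc0.ne'
  rcases factor_conn hfac eM fM key with h | h
  · left; rw [he, sub_eq_zero] at h; exact h.symm
  · right; rw [hf, sub_eq_zero] at h; exact h.symm

theorem good_one (hfac : ∀ z ∈ M, (∀ y ∈ M, z * y = y * z) → ∃ c : ℂ, z = c • (1 : H →L[ℂ] H)) :
    Good tr 1 := by
  obtain ⟨p, pM, psa, pp, pne, hp⟩ := exists_good_proj tr
  have tp : 0 < (tr.τ p).re := tau_pos tr pM (proj_nonneg psa pp) pne
  have main : ∀ n : ℕ, ∀ r ∈ M, star r = r → r * r = r → (tr.τ r).re < n * (tr.τ p).re →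
      Good tr r := by
    intro n
    induction n with
    | zero =>
      intro r rM rsa rr h
      have := tau_nonneg tr rM (proj_nonneg rsa rr)
      simp at h
      linarith
    | succ n ih =>
      intro r rM rsa rr h
      obtain ⟨v, vM, rv, vp, vvv, hor⟩ := compare hfac pM psa pp rM rsa rr
      have gv : Good tr (v * star v) := by
        have := hp.conj vM
        rwa [vp] at this
      rcases hor with h1 | h1
      · rwa [h1] at gv
      · have vr : star v * r = star v := by
          have := congrArg star rv
          rwa [star_mul, rsa] at this
        have g2 : Good tr (r - v * star v) := by
          refine ih _ (sub_mem rM (mul_mem vM (star_mem vM))) (by simp [rsa]) ?_ ?_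
          · rw [mul_sub, sub_mul, sub_mul, rr, mul_assoc v, vr, ← mul_assoc r, rv, ← mul_assoc,
              vvv]
            simp
          · rw [map_sub, tr.tracial v vM _ (star_mem vM), h1, Complex.sub_re]
            push_cast at h
            linarith
        have := g2.add gv
        rwa [sub_add_cancel] at this
  obtain ⟨n, hn⟩ := exists_nat_gt ((tr.τ 1).re / (tr.τ p).re)
  exact main n 1 (one_mem M) (star_one _) (one_mul _) ((div_lt_iff₀ tp).1 hn)

end CD

end

section
open scoped Classical ComplexOrder
set_option linter.unusedSectionVars false
namespace CD
open Filter Topology ContinuousLinearMap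
variable {H : Type} [NormedAddCommGroup H] [InnerProductSpace ℂ H] [CompleteSpace H]
variable {M : VonNeumannAlgebra H} (tr : TraceOn H (M : Set (H →L[ℂ] H)))

theorem riesz_dom {V E : Type*} [AddCommGroup V] [Module ℂ V] [NormedAddCommGroup E]
    [InnerProductSpace ℂ E] [CompleteSpace E] (T : V →ₗ[ℂ] E) (φ : V →ₗ[ℂ] ℂ) (C : ℝ)
    (h : ∀ x, ‖φ x‖ ≤ C * ‖T x‖) : ∃ η : E, ∀ x, φ x = inner ℂ η (T x) := by
  obtain ⟨g, hg⟩ := T.rangeRestrict.exists_rightInverse_of_surjective T.range_rangeRestrict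
  have hg' : ∀ t : LinearMap.range T, T (g t) = t := fun t =>
    congrArg Subtype.val (LinearMap.congr_fun hg t)
  let ψ : LinearMap.range T →L[ℂ] ℂ := (φ ∘ₗ g).mkContinuous C (by
    intro t
    have := h (g t)
    rwa [hg'] at this)
  obtain ⟨F, hF, -⟩ := exists_extension_norm_eq (LinearMap.range T) ψ
  refine ⟨(InnerProductSpace.toDual ℂ E).symm F, fun x => ?_⟩
  rw [InnerProductSpace.toDual_symm_apply]
  have h1 : F (T x) = φ (g ⟨T x, x, rfl⟩) := hF ⟨T x, x, rfl⟩
  rw [h1, ← sub_eq_zero, ← map_sub, ← norm_le_zero_iff]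
  refine (h _).trans ?_
  rw [map_sub, hg']
  simp

theorem tau_lim (h1 : Good tr 1) {ι : Type*} {l : Filter ι} {z : ι → (H →L[ℂ] H)}
    {w : H →L[ℂ] H} (hz : ∀ i, z i ∈ M) (hw : w ∈ M) (hl : WLim l z w) {y : H →L[ℂ] H}
    (hy : y ∈ M) : Tendsto (fun i => tr.τ (y * z i)) l (𝓝 (tr.τ (y * w))) := by
  obtain ⟨κ, _, ζ, hζ⟩ := h1
  let T : M.toStarSubalgebra →ₗ[ℂ] PiLp 2 (fun _ : κ => H) :=
    { toFun := fun x => WithLp.toLp 2 (fun i => (x : H →L[ℂ] H) (ζ i))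
      map_add' := fun a b => by ext i; simp
      map_smul' := fun a b => by ext i; simp }
  let φ : M.toStarSubalgebra →ₗ[ℂ] ℂ :=
    { toFun := fun x => tr.τ (y * (x : H →L[ℂ] H))
      map_add' := fun a b => by simp [mul_add]
      map_smul' := fun a b => by simp }
  obtain ⟨η, hη⟩ := riesz_dom T φ (√(tr.τ (y * star y)).re) (by
    rintro ⟨x, hx⟩
    have hx : x ∈ M := hx
    have hT : ‖T ⟨x, hx⟩‖ ^ 2 = ∑ i, ‖x (ζ i)‖ ^ 2 := by
      rw [PiLp.norm_sq_eq_of_L2]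
      rfl
    have cs := cauchy_schwarz tr hx (star_mem hy)
    have hx2 := hζ x hx
    rw [mul_one, tr.tracial _ hx _ (star_mem hx), ← hT] at hx2
    rw [star_star] at cs
    have h0 := (tr.nonneg _ (star_mem hy)).1
    rw [star_star] at h0
    change ‖tr.τ (y * x)‖ ≤ _
    refine abs_le_of_sq_le_sq' ?_ (by positivity) |>.2
    rw [mul_pow, Real.sq_sqrt h0]
    exact cs.trans (mul_le_mul_of_nonneg_left hx2 h0))
  have e : ∀ x ∈ M, tr.τ (y * x) = ∑ i, inner ℂ (η i) (x (ζ i)) := by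
    intro x hx
    exact hη ⟨x, hx⟩
  rw [e w hw]
  simp_rw [fun i => e (z i) (hz i)]
  exact tendsto_finsetSum _ (fun i _ => hl _ _)

theorem le_one_of_sa {x : H →L[ℂ] H} (hx : star x = x) (h1 : ‖x‖ ≤ 1) : 0 ≤ 1 - x ∧ 0 ≤ 1 + x := by
  have hsa : IsSelfAdjoint x := hx
  have hm : algebraMap ℝ (H →L[ℂ] H) ‖x‖ ≤ 1 := by
    rw [Algebra.algebraMap_eq_smul_one]
    have := smul_le_smul_of_nonneg_right h1 (zero_le_one (α := H →L[ℂ] H))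
    rwa [one_smul] at this
  refine ⟨sub_nonneg.2 (hsa.le_algebraMap_norm_self.trans hm), ?_⟩
  have h2 := hsa.neg.le_algebraMap_norm_self
  rw [norm_neg] at h2
  have := sub_nonneg.2 (h2.trans hm)
  rwa [sub_neg_eq_add] at this

/-- squared two-norm distance -/
def dist2 (x y : H →L[ℂ] H) : ℝ := (tr.τ ((x - y) * (x - y))).re

theorem tau_mul_nonneg {a b : H →L[ℂ] H} (ha : a ∈ M) (hb : b ∈ M) (a0 : 0 ≤ a) (b0 : 0 ≤ b) :
    0 ≤ (tr.τ (a * b)).re := by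
  obtain ⟨r, rM, r0, rfl⟩ := exists_sqrt M hb b0
  have rM' := star_mem rM
  rw [← mul_assoc, tr.tracial _ (mul_mem ha rM') _ rM, ← mul_assoc]
  exact tau_nonneg tr (mul_mem (mul_mem rM ha) rM') (star_right_conjugate_nonneg a0 r)

theorem clamp_dist {N : VonNeumannAlgebra H} (hN : ∀ y ∈ N, y ∈ M) {x y : H →L[ℂ] H}
    (xM : x ∈ M) (xsa : star x = x) (x1 : ‖x‖ ≤ 1) (yN : y ∈ N) (ysa : star y = y) :
    ∃ c ∈ N, star c = c ∧ ‖c‖ ≤ 1 ∧ dist2 tr x c ≤ dist2 tr x y := by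
  have hy : IsSelfAdjoint y := ysa
  obtain ⟨c, hc⟩ : ∃ c, c = cfc (fun t : ℝ => max (-1) (min t 1)) y := ⟨_, rfl⟩
  obtain ⟨P, hP⟩ : ∃ P, P = cfc (fun t : ℝ => max (t - 1) 0) y := ⟨_, rfl⟩
  obtain ⟨Q, hQ⟩ : ∃ Q, Q = cfc (fun t : ℝ => max (-1 - t) 0) y := ⟨_, rfl⟩
  have cN : c ∈ N := hc ▸ cfc_mem N yN _
  have PM : P ∈ M := hN _ (hP ▸ cfc_mem N yN _)
  have QM : Q ∈ M := hN _ (hQ ▸ cfc_mem N yN _)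
  have P0 : 0 ≤ P := hP ▸ cfc_nonneg (fun t _ => le_max_right _ _)
  have Q0 : 0 ≤ Q := hQ ▸ cfc_nonneg (fun t _ => le_max_right _ _)
  have csa : star c = c := by
    rw [hc]; exact (cfc_predicate (p := IsSelfAdjoint) _ y).star_eq
  have c1 : ‖c‖ ≤ 1 := by
    rw [hc]
    refine norm_cfc_le zero_le_one (fun t _ => ?_)
    rw [Real.norm_eq_abs, abs_le]
    exact ⟨le_max_left _ _, max_le (by norm_num) (min_le_right _ _)⟩
  have ecy : c - y = Q - P := by
    rw [hc, hP, hQ, ← cfc_sub (R := ℝ) _ _ y]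
    conv_lhs => rw [← cfc_id' ℝ y]
    rw [cfc_id' ℝ y]
    nth_rewrite 2 [← cfc_id' ℝ y]
    rw [← cfc_sub (R := ℝ) _ _ y]
    congr 1
    ext t
    grind
  have ecP : c * P = P := by
    rw [hc, hP, ← cfc_mul (R := ℝ) _ _ y]
    congr 1
    ext t
    rcases le_total (t - 1) 0 with h | h
    · simp [max_eq_right h]
    · have : (1:ℝ) ≤ t := by linarith
      simp [min_eq_right this]
  have ecQ : c * Q = -Q := by
    rw [hc, hQ, ← cfc_neg (R := ℝ) _ y, ← cfc_mul (R := ℝ) _ _ y]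
    congr 1
    ext t
    rcases le_total (-1 - t) 0 with h | h
    · simp [max_eq_right h]
    · have : t ≤ (-1:ℝ) := by linarith
      rw [max_eq_left h, min_eq_left (by linarith), max_eq_left this]
      ring
  refine ⟨c, cN, csa, c1, ?_⟩
  have cM := hN _ cN
  have yM := hN _ yN
  obtain ⟨m1, p1⟩ := le_one_of_sa xsa x1
  have k1 := tau_mul_nonneg tr (sub_mem (one_mem M) xM) PM m1 P0
  have k2 := tau_mul_nonneg tr (add_mem (one_mem M) xM) QM p1 Q0
  have k3 : (x - c) * (c - y) = (1 - x) * P + (1 + x) * Q := by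
    rw [ecy, sub_mul, mul_sub, mul_sub, ecP, ecQ, sub_mul, add_mul, one_mul, one_mul]
    abel
  have k4 : 0 ≤ (tr.τ ((x - c) * (c - y))).re := by
    rw [k3, map_add, Complex.add_re]; exact add_nonneg k1 k2
  have k5 : 0 ≤ (tr.τ ((c - y) * (c - y))).re := by
    have := (tr.nonneg _ (sub_mem cM yM)).1
    rwa [star_sub, csa, ysa] at this
  have k6 : (x - y) * (x - y) = (x - c) * (x - c) + (x - c) * (c - y) + (c - y) * (x - c)
      + (c - y) * (c - y) := by noncomm_ring
  rw [dist2, dist2, k6, map_add, map_add, map_add,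
    tr.tracial _ (sub_mem cM yM) _ (sub_mem xM cM)]
  simp only [Complex.add_re]
  linarith

theorem exists_min (h1 : Good tr 1) {N : VonNeumannAlgebra H} (hN : ∀ y ∈ N, y ∈ M)
    {x : H →L[ℂ] H} (xM : x ∈ M) (xsa : star x = x) :
    ∃ h ∈ N, star h = h ∧ ∀ y ∈ N, star y = y → ‖y‖ ≤ 1 → dist2 tr x h ≤ dist2 tr x y := by
  let S : Set (H →L[ℂ] H) := {y | y ∈ N ∧ star y = y ∧ ‖y‖ ≤ 1}
  have d0 : ∀ y ∈ S, 0 ≤ dist2 tr x y := by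
    intro y hy
    have := (tr.nonneg _ (sub_mem xM (hN y hy.1))).1
    rwa [star_sub, xsa, hy.2.1] at this
  have hbdd : BddBelow (dist2 tr x '' S) := ⟨0, by rintro _ ⟨y, hy, rfl⟩; exact d0 y hy⟩
  have hne : (dist2 tr x '' S).Nonempty := ⟨_, 0, ⟨zero_mem N, by simp, by simp⟩, rfl⟩
  set d := sInf (dist2 tr x '' S) with hd
  have hseq : ∀ n : ℕ, ∃ y ∈ S, dist2 tr x y < d + 1 / ((n : ℝ) + 1) := by
    intro n
    obtain ⟨_, ⟨y, hy, rfl⟩, h⟩ := exists_lt_of_csInf_lt hne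
      (show d < d + 1 / ((n : ℝ) + 1) by linarith [Nat.one_div_pos_of_nat (α := ℝ) (n := n)])
    exact ⟨y, hy, h⟩
  choose y hyS hyd using hseq
  obtain ⟨h, h1', hl⟩ := exists_wlim (hyperfilter ℕ) y 1 (fun n => (hyS n).2.2)
  have hhN : h ∈ N := hl.mem N (fun n => (hyS n).1)
  have hsa : star h = h := by
    have hs := hl.star
    ext v
    refine ext_inner_left ℂ (fun g => tendsto_nhds_unique (hs g v) ?_)
    refine (hl g v).congr (fun n => ?_)
    change _ = inner ℂ g ((star (y n)) v)
    rw [(hyS n).2.1]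
  refine ⟨h, hhN, hsa, fun k kN ksa k1 => ?_⟩
  have hdk : d ≤ dist2 tr x k := csInf_le hbdd ⟨k, ⟨kN, ksa, k1⟩, rfl⟩
  refine le_trans ?_ hdk
  have xhM : x - h ∈ M := sub_mem xM (hN h hhN)
  have hS : h ∈ S := ⟨hhN, hsa, h1'⟩
  have t1 := tau_lim tr h1 (z := fun n => x - y n) (fun n => sub_mem xM (hN _ (hyS n).1)) xhM
    (hl.const_sub x) xhM
  have t2 : Tendsto (fun n : ℕ => dist2 tr x h * (d + 1 / ((n : ℝ) + 1)))
      (hyperfilter ℕ : Filter ℕ) (𝓝 (dist2 tr x h * (d + 0))) :=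
    ((tendsto_one_div_add_atTop_nhds_zero_nat.mono_left Nat.hyperfilter_le_atTop).const_add
      d).const_mul _
  have t3 := (t1.norm).pow 2
  have t4 := le_of_tendsto_of_tendsto' t3 t2 (fun n => by
    have cs := cauchy_schwarz tr (x := x - y n) (y := x - h) (sub_mem xM (hN _ (hyS n).1)) xhM
    rw [star_sub, star_sub, xsa, hsa, (hyS n).2.1] at cs
    exact cs.trans (mul_le_mul_of_nonneg_left (hyd n).le (d0 h hS)))
  have t5 : dist2 tr x h ≤ ‖tr.τ ((x - h) * (x - h))‖ := Complex.re_le_norm _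
  have hd0 : 0 ≤ d := le_csInf hne (by rintro _ ⟨y, hy, rfl⟩; exact d0 y hy)
  have h00 := d0 h hS
  rw [add_zero] at t4
  by_contra hcon
  push Not at hcon
  nlinarith

theorem exp_sa (h1 : Good tr 1) {N : VonNeumannAlgebra H} (hN : ∀ y ∈ N, y ∈ M)
    {x : H →L[ℂ] H} (xM : x ∈ M) (xsa : star x = x) (x1 : ‖x‖ ≤ 1) :
    ∃ h ∈ N, ∀ k ∈ N, tr.τ (h * k) = tr.τ (x * k) := by
  obtain ⟨h, hhN, hsa, hmin⟩ := exists_min tr h1 hN xM xsa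
  have xhM : x - h ∈ M := sub_mem xM (hN h hhN)
  have key : ∀ k ∈ N, star k = k → tr.τ ((x - h) * k) = 0 := by
    intro k kN ksa
    have kM := hN k kN
    have him : (tr.τ ((x - h) * k)).im = 0 := by
      have := tr.star_eq _ (mul_mem xhM kM)
      rw [star_mul, ksa, star_sub, xsa, hsa, tr.tracial _ kM _ xhM] at this
      exact Complex.conj_eq_iff_im.1 this.symm
    have hq : ∀ t : ℝ, 0 ≤ t ^ 2 * (tr.τ (k * k)).re - 2 * t * (tr.τ ((x - h) * k)).re := by
      intro t
      have tk : (t : ℂ) • k ∈ N := smul_memV N _ kN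
      obtain ⟨c, cN, csa, c1, hc⟩ := clamp_dist tr hN xM xsa x1 (add_mem hhN tk)
        (by simp [hsa, ksa])
      have h2 := (hmin c cN csa c1).trans hc
      have e : (x - (h + (t : ℂ) • k)) * (x - (h + (t : ℂ) • k)) = (x - h) * (x - h)
          - (t : ℂ) • ((x - h) * k) - (t : ℂ) • (k * (x - h)) + ((t : ℂ) * t) • (k * k) := by
        rw [← sub_sub, sub_mul, mul_sub, smul_mul_assoc, mul_sub k, mul_smul_comm,
          mul_smul_comm, smul_sub, smul_smul]
        abel
      rw [dist2, dist2, e] at h2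
      simp only [map_add, map_sub, map_smul, tr.tracial _ kM _ xhM] at h2
      simp at h2
      nlinarith
    refine Complex.ext ?_ him
    simp only [Complex.zero_re]
    set A := (tr.τ (k * k)).re
    set B := (tr.τ ((x - h) * k)).re
    have hA : 0 ≤ A := by
      have := (tr.nonneg k kM).1
      rwa [ksa] at this
    by_contra hB
    have h3 := hq (B / (A + 1))
    have hB2 : 0 < B ^ 2 := by positivity
    have e : (B / (A + 1)) ^ 2 * A - 2 * (B / (A + 1)) * B = - (B ^ 2 * (A + 2)) / (A + 1) ^ 2 := by
      field_simp
      ring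
    rw [e] at h3
    have : 0 < (B ^ 2 * (A + 2)) / (A + 1) ^ 2 := by positivity
    rw [neg_div] at h3
    linarith
  refine ⟨h, hhN, fun k kN => ?_⟩
  have ek : k = (1 / 2 : ℂ) • (k + star k) - (Complex.I / 2) • (Complex.I • (k - star k)) := by
    rw [smul_smul, show Complex.I / 2 * Complex.I = (-1 / 2 : ℂ) by
      rw [div_mul_eq_mul_div, Complex.I_mul_I]]
    module
  have a1 := key (k + star k) (add_mem kN (star_mem kN)) (by simp [add_comm])
  have a2 := key (Complex.I • (k - star k)) (smul_memV N _ (sub_mem kN (star_mem kN))) (by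
    simp [star_smul, ← smul_neg])
  have a3 : tr.τ ((x - h) * k) = 0 := by
    rw [ek, mul_sub, mul_smul_comm, mul_smul_comm, map_sub, map_smul, map_smul, a1, a2]
    simp
  rw [sub_mul, map_sub, sub_eq_zero] at a3
  exact a3.symm

theorem exp_sa' (h1 : Good tr 1) {N : VonNeumannAlgebra H} (hN : ∀ y ∈ N, y ∈ M)
    {x : H →L[ℂ] H} (xM : x ∈ M) (xsa : star x = x) :
    ∃ h ∈ N, ∀ k ∈ N, tr.τ (h * k) = tr.τ (x * k) := by
  obtain ⟨c, hc⟩ : ∃ c : ℝ, c = ‖x‖ + 1 := ⟨_, rfl⟩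
  have hc0 : 0 < c := by rw [hc]; positivity
  obtain ⟨h, hhN, hh⟩ := exp_sa tr h1 hN (x := ((c⁻¹ : ℝ) : ℂ) • x) (smul_memV M _ xM)
    (by simp [xsa]) (by
      rw [norm_smul, Complex.norm_real, Real.norm_of_nonneg (by positivity),
        inv_mul_le_one₀ hc0]
      linarith)
  refine ⟨(c : ℂ) • h, smul_memV N _ hhN, fun k kN => ?_⟩
  rw [smul_mul_assoc, map_smul, hh k kN, smul_mul_assoc, map_smul, smul_eq_mul, smul_eq_mul,
    ← mul_assoc, ← Complex.ofReal_mul, mul_inv_cancel₀ hc0.ne']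
  simp

theorem exists_exp (h1 : Good tr 1) {N : VonNeumannAlgebra H} (hN : ∀ y ∈ N, y ∈ M)
    {x : H →L[ℂ] H} (xM : x ∈ M) :
    ∃ h ∈ N, ∀ k ∈ N, tr.τ (h * k) = tr.τ (x * k) := by
  obtain ⟨a, aN, ha⟩ := exp_sa' tr h1 hN (add_mem xM (star_mem xM)) (by simp [add_comm])
  obtain ⟨b, bN, hb⟩ := exp_sa' tr h1 hN (x := Complex.I • (x - star x))
    (smul_memV M _ (sub_mem xM (star_mem xM))) (by simp [star_smul, ← smul_neg])
  have ek : x = (1 / 2 : ℂ) • (x + star x) - (Complex.I / 2) • (Complex.I • (x - star x)) := by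
    rw [smul_smul, show Complex.I / 2 * Complex.I = (-1 / 2 : ℂ) by
      rw [div_mul_eq_mul_div, Complex.I_mul_I]]
    module
  refine ⟨(1 / 2 : ℂ) • a - (Complex.I / 2) • b, sub_mem (smul_memV N _ aN) (smul_memV N _ bN),
    fun k kN => ?_⟩
  conv_rhs => rw [ek]
  rw [sub_mul, sub_mul, smul_mul_assoc, smul_mul_assoc, smul_mul_assoc (1/2 : ℂ) (x + star x),
    smul_mul_assoc (Complex.I / 2) (Complex.I • (x - star x)), map_sub, map_sub, map_smul,
    map_smul, map_smul, map_smul, ha k kN, hb k kN]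

end CD

end

section
open scoped Classical ComplexOrder
set_option linter.unusedSectionVars false
namespace CD
open Filter Topology ContinuousLinearMap
variable {H : Type} [NormedAddCommGroup H] [InnerProductSpace ℂ H] [CompleteSpace H]
variable {Γ : Type} [Group Γ] (X : CrossedProduct Γ H)

theorem EA_zero_iff {z : H →L[ℂ] H} (hz : z ∈ X.M) :
    X.EA.E z = 0 ↔ ∀ a ∈ X.A, X.tr.τ (z * a) = 0 := by
  have hb : ∀ a ∈ X.A, X.tr.τ (z * a) = X.tr.τ (X.EA.E z * a) := by
    intro a ha
    rw [← X.EA.trace_eq _ (mul_mem hz (X.A_sub ha))]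
    have := X.EA.bimod 1 (one_mem X.A) a ha z hz
    rw [one_mul, one_mul] at this
    rw [this]
  constructor
  · intro h a ha
    rw [hb a ha, h, zero_mul, map_zero]
  · intro h
    have hE : X.EA.E z ∈ X.A := X.EA.mem z hz
    have hs : star (X.EA.E z) ∈ X.A := star_mem hE
    have h1 := h _ hs
    rw [hb _ hs, X.tr.tracial _ (X.A_sub hE) _ (X.A_sub hs)] at h1
    exact X.tr.faithful _ (X.A_sub hE) h1

theorem u_mul_star (γ : Γ) : X.u γ * star (X.u γ) = 1 := by
  rw [X.u_star, X.u_mul, mul_inv_cancel, X.u_one]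

theorem u_star_mul (γ : Γ) : star (X.u γ) * X.u γ = 1 := by
  rw [X.u_star, X.u_mul, inv_mul_cancel, X.u_one]

theorem EA_conj {y : H →L[ℂ] H} (hy : y ∈ X.M) (h : X.EA.E y = 0) (γ : Γ) :
    X.EA.E (X.u γ * y * star (X.u γ)) = 0 := by
  have uM := X.u_mem γ
  have uM' : star (X.u γ) ∈ X.M := star_mem uM
  rw [EA_zero_iff X (mul_mem (mul_mem uM hy) uM')]
  intro a ha
  have aM : a ∈ X.M := X.A_sub ha
  have h1 := X.conj_mem γ⁻¹ a ha
  rw [← X.u_star, star_star] at h1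
  have h2 := (EA_zero_iff X hy).1 h _ h1
  rw [← h2, mul_assoc, mul_assoc, X.tr.tracial _ uM _ (mul_mem hy (mul_mem uM' aM))]
  simp only [mul_assoc]

theorem conj_subgp {Λ : Subgroup Γ} (hΛ : Λ.Normal) (γ : Γ) {q : H →L[ℂ] H}
    (hq : q ∈ subgpCP X Λ) : X.u γ * q * star (X.u γ) ∈ subgpCP X Λ := by
  refine ⟨mul_mem (mul_mem (X.u_mem γ) hq.1) (star_mem (X.u_mem γ)), fun δ hδ => ?_⟩
  have hδ' : γ⁻¹ * δ * γ ∉ Λ := by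
    intro h
    have := hΛ.conj_mem _ h γ
    apply hδ
    simpa [mul_assoc] using this
  have h1 := hq.2 _ hδ'
  have h2 := EA_conj X (mul_mem hq.1 (star_mem (X.u_mem (γ⁻¹ * δ * γ)))) h1 γ
  rw [← h2]
  congr 1
  simp only [X.u_star, mul_assoc, X.u_mul]
  congr 3
  group

theorem u_mem_subgp {K : Subgroup Γ} {κ : Γ} (h : κ ∈ K) : X.u κ ∈ subgpCP X K := by
  refine ⟨X.u_mem κ, fun δ hδ => ?_⟩
  rw [X.u_star, X.u_mul]
  refine X.EA_u _ (fun h1 => hδ ?_)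
  have : κ = δ := by rwa [mul_inv_eq_one] at h1
  exact this ▸ h

theorem A_sub_subgp {K : Subgroup Γ} {a : H →L[ℂ] H} (ha : a ∈ X.A) : a ∈ subgpCP X K := by
  refine ⟨X.A_sub ha, fun δ hδ => ?_⟩
  have := X.EA.bimod a ha 1 (one_mem X.A) (X.u δ⁻¹) (X.u_mem _)
  rw [mul_one, mul_one] at this
  rw [X.u_star, this, X.EA_u, mul_zero]
  intro h
  apply hδ
  rw [inv_eq_one.1 h]
  exact K.one_mem

theorem main_aux (Λ : Subgroup Γ) (hΛ : Λ.Normal)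
    (hirr : commutantIn (subgpCP X Λ) (X.M : Set (H →L[ℂ] H)) = scalars H)
    (N : VonNeumannAlgebra H)
    (hN₁ : subgpCP X Λ ⊆ (N : Set (H →L[ℂ] H)))
    (hN₂ : (N : Set (H →L[ℂ] H)) ⊆ (X.M : Set (H →L[ℂ] H))) :
    ∃ K : Subgroup Γ, Λ ≤ K ∧ (N : Set (H →L[ℂ] H)) = subgpCP X K := by
  have hN : ∀ y ∈ N, y ∈ X.M := fun y hy => hN₂ hy
  have hQ : ∀ y ∈ subgpCP X Λ, y ∈ N := fun y hy => hN₁ hy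
  have hscal : ∀ z ∈ X.M, (∀ y ∈ subgpCP X Λ, z * y = y * z) →
      ∃ c : ℂ, z = c • (1 : H →L[ℂ] H) := by
    intro z hz h
    have : z ∈ commutantIn (subgpCP X Λ) (X.M : Set (H →L[ℂ] H)) := ⟨hz, h⟩
    rw [hirr] at this
    obtain ⟨c, hc⟩ := this
    exact ⟨c, hc.symm⟩
  have hgood : Good X.tr 1 := good_one X.tr (fun z hz h => hscal z hz (fun y hy => h y hy.1))
  let K : Subgroup Γ :=
    { carrier := {γ | X.u γ ∈ N}
      one_mem' := by
        change X.u 1 ∈ N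
        rw [X.u_one]; exact one_mem N
      mul_mem' := by
        intro a b ha hb
        change X.u (a * b) ∈ N
        rw [← X.u_mul]; exact mul_mem ha hb
      inv_mem' := by
        intro a ha
        change X.u a⁻¹ ∈ N
        rw [← X.u_star]; exact star_mem ha }
  have hAN : ∀ a ∈ X.A, a ∈ N := fun a ha => hQ a (A_sub_subgp X ha)
  have key : ∀ γ, γ ∉ K → ∀ k ∈ N, X.tr.τ (X.u γ * k) = 0 := by
    intro γ hγ
    have uM := X.u_mem γ
    obtain ⟨h, hhN, hh⟩ := exists_exp X.tr hgood hN uM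
    have hM := hN h hhN
    have hqcomm : ∀ q ∈ subgpCP X Λ, X.u γ * q * star (X.u γ) * h = h * q := by
      intro q hq
      have sN : X.u γ * q * star (X.u γ) ∈ N := hQ _ (conj_subgp X hΛ γ hq)
      have su : X.u γ * q * star (X.u γ) * X.u γ = X.u γ * q := by
        rw [mul_assoc, u_star_mul, mul_one]
      obtain ⟨s, hs⟩ : ∃ s, s = X.u γ * q * star (X.u γ) := ⟨_, rfl⟩
      rw [← hs] at sN su ⊢
      have qN := hQ q hq
      have dN : s * h - h * q ∈ N := sub_mem (mul_mem sN hhN) (mul_mem hhN qN)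
      have hd : ∀ k ∈ N, X.tr.τ ((s * h - h * q) * k) = 0 := by
        intro k kN
        rw [sub_mul, map_sub, mul_assoc s,
          X.tr.tracial _ (hN _ sN) _ (mul_mem hM (hN k kN)), mul_assoc, hh _ (mul_mem kN sN),
          mul_assoc, hh _ (mul_mem qN kN), ← mul_assoc,
          X.tr.tracial _ (mul_mem uM (hN k kN)) _ (hN _ sN), ← mul_assoc, su, mul_assoc, sub_self]
      have h0 := hd _ (star_mem dN)
      rw [X.tr.tracial _ (hN _ dN) _ (hN _ (star_mem dN))] at h0
      exact sub_eq_zero.1 (X.tr.faithful _ (hN _ dN) h0)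
    obtain ⟨c, hc⟩ := hscal (star (X.u γ) * h) (mul_mem (star_mem uM) hM) (by
      intro q hq
      rw [mul_assoc, ← hqcomm q hq, ← mul_assoc, ← mul_assoc, ← mul_assoc, u_star_mul, one_mul,
        mul_assoc])
    have hcu : h = c • X.u γ := by
      have := congrArg (fun t => X.u γ * t) hc
      simp only [← mul_assoc, u_mul_star, one_mul, mul_smul_comm, mul_one] at this
      exact this
    have c0 : c = 0 := by
      by_contra hne
      apply hγ
      change X.u γ ∈ N
      have : X.u γ = c⁻¹ • h := by rw [hcu, smul_smul, inv_mul_cancel₀ hne, one_smul]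
      rw [this]
      exact smul_memV N _ hhN
    intro k kN
    rw [← hh k kN, hcu, c0, zero_smul, zero_mul, map_zero]
  have hNK : ∀ x ∈ N, x ∈ subgpCP X K := by
    intro x hx
    have xM := hN x hx
    refine ⟨xM, fun γ hγ => ?_⟩
    have uM' : star (X.u γ) ∈ X.M := star_mem (X.u_mem γ)
    rw [EA_zero_iff X (mul_mem xM uM')]
    intro a ha
    have hγ' : γ⁻¹ ∉ K := fun h => hγ (by simpa using K.inv_mem h)
    rw [mul_assoc, X.tr.tracial _ xM _ (mul_mem uM' (X.A_sub ha)), mul_assoc, X.u_star]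
    exact key _ hγ' _ (mul_mem (hAN a ha) hx)
  refine ⟨K, fun γ hγ => hQ _ (u_mem_subgp X hγ), Set.Subset.antisymm hNK ?_⟩
  intro x hx
  obtain ⟨h, hhN, hh⟩ := exists_exp X.tr hgood hN hx.1
  have hM := hN h hhN
  have w0 : x - h = 0 := by
    refine X.fourier_sep _ (sub_mem hx.1 hM) (fun γ => ?_)
    by_cases hγ : γ ∈ K
    · rw [EA_zero_iff X (mul_mem (sub_mem hx.1 hM) (star_mem (X.u_mem γ)))]
      intro a ha
      have hu : X.u γ ∈ N := hγ
      rw [mul_assoc, sub_mul, map_sub, hh _ (mul_mem (star_mem hu) (hAN a ha)), sub_self]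
    · rw [sub_mul, map_sub, hx.2 γ hγ, (hNK h hhN).2 γ hγ, sub_self]
  rw [sub_eq_zero.1 w0]
  exact hhN

end CD

end

open CD in
/-- Theorem `galoiscorr`. Let `Λ ◁ Γ` be a normal subgroup and
`Γ ↷ (P, τ)` a trace-preserving action with `(P ⋊ Λ)' ∩ (P ⋊ Γ) = ℂ1`. Then every
intermediate von Neumann subalgebra `P ⋊ Λ ⊆ N ⊆ P ⋊ Γ` is of the form `P ⋊ K` for
an intermediate subgroup `Λ ≤ K ≤ Γ`. -/
theorem stmt14_galois_correspondence
    (Γ : Type) [Group Γ] [Countable Γ]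
    (Λ : Subgroup Γ) (hΛ : Λ.Normal)
    (H : Type) [NormedAddCommGroup H] [InnerProductSpace ℂ H] [CompleteSpace H]
    -- the crossed product `P ⋊ Γ`, with `P = X.A`
    (X : CrossedProduct Γ H)
    -- `(P ⋊ Λ)' ∩ (P ⋊ Γ) = ℂ1`
    (hirr : commutantIn (subgpCP X Λ) (X.M : Set (H →L[ℂ] H)) = scalars H)
    -- an intermediate von Neumann subalgebra `P ⋊ Λ ⊆ N ⊆ P ⋊ Γ`
    (N : VonNeumannAlgebra H)
    (hN₁ : subgpCP X Λ ⊆ (N : Set (H →L[ℂ] H)))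
    (hN₂ : (N : Set (H →L[ℂ] H)) ⊆ (X.M : Set (H →L[ℂ] H))) :
    ∃ K : Subgroup Γ, Λ ≤ K ∧ (N : Set (H →L[ℂ] H)) = subgpCP X K := by
  exact CD.main_aux X Λ hΛ hirr N hN₁ hN₂
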